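/- There exist constants K > 0 and C₀ > 0 such that for every natural number M and every irrational θ ∈ [0,1] there exist: a natural number N with N ≤ C₀·exp(M²); a sequence (m_j)_{j≥1} of positive integers with m_j/m_{j+1} ≤ 3^{−2N} for all j; a complex Hilbert space H; unitary operators U, V on H satisfying U·V = e^{2πiθ}·V·U; and a unit vector e₀ ∈ H with ⟨U^{a}V^{b}·e₀, e₀⟩ = 0 for all (a,b) ∈ ℤ² ∖ {(0,0)}; such that, with τ(T) := ⟨T·e₀, e₀⟩, the modified Riesz product W_N built from U, V, (m_j) satisfies max{ τ(|δ₁²(W_N)|), τ(|δ₂²(W_N)|) } ≤ K and τ(|δ₁δ₂(W_N)|) ≥ M. -/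

import Mathlib

open scoped Real
open Complex

noncomputable section

/-- A bundled complex Hilbert space. -/
structure HilbertSetup where
  H : Type
  [normed : NormedAddCommGroup H]
  [ips : InnerProductSpace ℂ H]
  [complete : CompleteSpace H]

attribute [instance] HilbertSetup.normed HilbertSetup.ips HilbertSetup.complete

variable {H : Type*} [NormedAddCommGroup H] [InnerProductSpace ℂ H] [CompleteSpace H]

/-- The monomial `U^{k₁} V^{k₂}`. -/
def qMono (U V : unitary (H →L[ℂ] H)) (k : ℤ × ℤ) : H →L[ℂ] H :=
  ((U ^ k.1 * V ^ k.2 : unitary (H →L[ℂ] H)) : H →L[ℂ] H)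

/-- The vector state `τ(T) = ⟨T e₀, e₀⟩` (in Mathlib's convention `⟪e₀, T e₀⟫`). -/
def vecState (e₀ : H) (T : H →L[ℂ] H) : ℂ :=
  @inner ℂ H _ e₀ (T e₀)

/-- The absolute value `|T| = (T^* T)^{1/2}` of a bounded operator. -/
def opAbs (T : H →L[ℂ] H) : H →L[ℂ] H :=
  CFC.sqrt (star T * T)

/-- The non-commutative `L¹` quantity `τ(|T|)`, a real number since `|T| ≥ 0`. -/
def l1Norm (e₀ : H) (T : H →L[ℂ] H) : ℝ :=
  (vecState e₀ (opAbs T)).re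

/-- The factor `p_j = I + (1/2)(U^{(−1)^{j−1} m_j} V^{m_j} + V^{−m_j} U^{−(−1)^{j−1} m_j})`. -/
def rieszFactor (U V : unitary (H →L[ℂ] H)) (m : ℕ → ℕ) (j : ℕ) : H →L[ℂ] H :=
  1 + (2⁻¹ : ℂ) •
    (((U ^ ((-1 : ℤ) ^ (j - 1) * (m j : ℤ)) * V ^ (m j : ℤ) :
        unitary (H →L[ℂ] H)) : H →L[ℂ] H)
      + ((V ^ (-(m j : ℤ)) * U ^ (-((-1 : ℤ) ^ (j - 1) * (m j : ℤ))) :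
        unitary (H →L[ℂ] H)) : H →L[ℂ] H))

/-- The non-commutative Riesz product `P_N = p_N ⋯ p_1` (with `P_0 = I`). -/
def rieszProd (U V : unitary (H →L[ℂ] H)) (m : ℕ → ℕ) : ℕ → H →L[ℂ] H
  | 0 => 1
  | N + 1 => rieszFactor U V m (N + 1) * rieszProd U V m N

/-- The Fourier coefficient `T̂(k) = τ((U^{k₁}V^{k₂})^* T)`. -/
def qFourier (e₀ : H) (U V : unitary (H →L[ℂ] H)) (T : H →L[ℂ] H) (k : ℤ × ℤ) : ℂ :=
  vecState e₀ (star (qMono U V k) * T)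

/-- The base lattice vector `((−1)^{l−1} m_l, m_l) ∈ ℤ²`. -/
def baseVec (m : ℕ → ℕ) (l : ℕ) : ℤ × ℤ :=
  ((-1 : ℤ) ^ (l - 1) * (m l : ℤ), (m l : ℤ))

/-- The combinatorial set
`M_j = { ((−1)^{j−1}m_j, m_j) + Σ_{l=1}^{j−1} ξ_l ((−1)^{l−1}m_l, m_l) : ξ_l ∈ {−1,0,1} }`. -/
def Mset (m : ℕ → ℕ) (j : ℕ) : Finset (ℤ × ℤ) :=
  Finset.image
    (fun ξ : Fin (j - 1) → Fin 3 =>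
      baseVec m j + ∑ l : Fin (j - 1), (((ξ l : ℕ) : ℤ) - 1) • baseVec m ((l : ℕ) + 1))
    Finset.univ

/-- The `i`-th coordinate of `k ∈ ℤ²` (`i = 1` gives `k₁`, `i = 2` gives `k₂`). -/
def kCoord (i : ℕ) (k : ℤ × ℤ) : ℤ := if i = 1 then k.1 else k.2

/-- `δ_a δ_b (W_N)`: the coefficientwise derivative of the modified Riesz product
`W_N = −(1/4π²) Σ_{j=1}^{N} Σ_{k ∈ M_j} k₂^{−2} (P̂_N(k) U^{k₁}V^{k₂} + P̂_N(−k) U^{−k₁}V^{−k₂})`,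
the coefficient of `U^{k₁}V^{k₂}` being multiplied by `(2πi k_a)(2πi k_b)`. -/
def derivW (e₀ : H) (U V : unitary (H →L[ℂ] H)) (m : ℕ → ℕ) (N : ℕ) (a b : ℕ) : H →L[ℂ] H :=
  (-(1 / (4 * (π : ℂ) ^ 2))) •
    ∑ j ∈ Finset.Icc 1 N, ∑ k ∈ Mset m j,
      ((((k.2 : ℂ) ^ 2)⁻¹ *
          ((2 * (π : ℂ) * Complex.I * (kCoord a k : ℂ)) *
            (2 * (π : ℂ) * Complex.I * (kCoord b k : ℂ))) *
          qFourier e₀ U V (rieszProd U V m N) k) • qMono U V k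
        + (((k.2 : ℂ) ^ 2)⁻¹ *
          ((2 * (π : ℂ) * Complex.I * (kCoord a (-k) : ℂ)) *
            (2 * (π : ℂ) * Complex.I * (kCoord b (-k) : ℂ))) *
          qFourier e₀ U V (rieszProd U V m N) (-k)) • qMono U V (-k))

end

/-- `H` carries unitaries `U`, `V` with `U V = ω V U` and a unit vector `e` at which the vector
state vanishes on all non-trivial monomials. -/
structure IsTraceVector {H : Type*} [NormedAddCommGroup H] [InnerProductSpace ℂ H]
    [CompleteSpace H] (U V : unitary (H →L[ℂ] H)) (ω : ℂ) (e : H) : Prop where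
  comm : (U : H →L[ℂ] H) * (V : H →L[ℂ] H) = ω • ((V : H →L[ℂ] H) * (U : H →L[ℂ] H))
  norm_phase : ‖ω‖ = 1
  norm_vec : ‖e‖ = 1
  vecState_qMono : ∀ k : ℤ × ℤ, k ≠ 0 → vecState e (qMono U V k) = 0

namespace HilbertBasis

variable {ι H : Type*} [NormedAddCommGroup H] [InnerProductSpace ℂ H]

/-- A Hilbert basis stays a Hilbert basis after permuting it and multiplying its vectors by
phases. -/
theorem exists_linearIsometryEquiv [CompleteSpace H] (b : HilbertBasis ι ℂ H) (σ : ι ≃ ι)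
    (z : ι → ℂ)
    (hz : ∀ i, ‖z i‖ = 1) : ∃ T : H ≃ₗᵢ[ℂ] H, ∀ i, T (b i) = z i • b (σ i) := by
  classical
  have hz0 : ∀ i, z i ≠ 0 := fun i h => by simpa [h] using hz i
  have hon : Orthonormal ℂ (fun i => z i • b (σ i)) := by
    have hb := b.orthonormal.comp σ σ.injective
    refine ⟨fun i => ?_, fun i j hij => ?_⟩
    · have := hb.1 i
      simp only [Function.comp_apply] at this
      simp [norm_smul, hz, this]
    · have := hb.2 hij
      simp only [Function.comp_apply] at this
      simp [inner_smul_left, inner_smul_right, this]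
  have hsp : ⊤ ≤ (Submodule.span ℂ (Set.range fun i => z i • b (σ i))).topologicalClosure := by
    rw [← b.dense_span]
    refine Submodule.topologicalClosure_mono (Submodule.span_le.2 ?_)
    rintro _ ⟨i, rfl⟩
    have h1 : z (σ.symm i) • b i ∈ Submodule.span ℂ (Set.range fun i => z i • b (σ i)) :=
      Submodule.subset_span ⟨σ.symm i, by simp⟩
    have h2 := Submodule.smul_mem _ (z (σ.symm i))⁻¹ h1
    rwa [smul_smul, inv_mul_cancel₀ (hz0 _), one_smul] at h2
  let b' := HilbertBasis.mk hon hsp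
  refine ⟨b.repr.trans b'.repr.symm, fun i => ?_⟩
  have : b' i = z i • b (σ i) := by simp [b']
  rw [← this, LinearIsometryEquiv.trans_apply, b.repr_self, b'.repr_symm_single]

theorem continuousLinearMap_ext (b : HilbertBasis ι ℂ H) {S T : H →L[ℂ] H}
    (h : ∀ i, S (b i) = T (b i)) : S = T := by
  refine ContinuousLinearMap.ext_on (s := Set.range b) ?_ ?_
  · rw [dense_iff_closure_eq, ← Submodule.topologicalClosure_coe, b.dense_span]; rfl
  · rintro _ ⟨i, rfl⟩; exact h i

end HilbertBasis

/-- The irrational rotation algebra acts on `ℓ²(ℤ²)` by weighted shifts. -/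
theorem exists_isTraceVector (ω : ℂ) (hω : ‖ω‖ = 1) :
    ∃ S : HilbertSetup, ∃ U V : unitary (S.H →L[ℂ] S.H), ∃ e : S.H, IsTraceVector U V ω e := by
  have hω0 : ω ≠ 0 := fun h => by simp [h] at hω
  let S : HilbertSetup := ⟨lp (fun _ : ℤ × ℤ => ℂ) 2⟩
  let b : HilbertBasis (ℤ × ℤ) ℂ S.H := ⟨LinearIsometryEquiv.refl ℂ _⟩
  obtain ⟨TU, hTU⟩ := b.exists_linearIsometryEquiv (Equiv.addRight ((1, 0) : ℤ × ℤ)) (fun _ => 1)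
    (by simp)
  obtain ⟨TV, hTV⟩ := b.exists_linearIsometryEquiv (Equiv.addRight ((0, 1) : ℤ × ℤ))
    (fun k => ω ^ (-k.1)) (by simp [hω])
  let U : unitary (S.H →L[ℂ] S.H) := Unitary.linearIsometryEquiv.symm TU
  let V : unitary (S.H →L[ℂ] S.H) := Unitary.linearIsometryEquiv.symm TV
  have hU : ∀ i, (U : S.H →L[ℂ] S.H) (b i) = b (i + (1, 0)) := fun i => by
    exact (hTU i).trans (one_smul ℂ _)
  have hV : ∀ i, (V : S.H →L[ℂ] S.H) (b i) = ω ^ (-i.1) • b (i + (0, 1)) := fun i => by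
    exact hTV i
  have hcoe : ∀ (A B : unitary (S.H →L[ℂ] S.H)) (x : S.H),
      ((A * B : unitary (S.H →L[ℂ] S.H)) : S.H →L[ℂ] S.H) x
        = (A : S.H →L[ℂ] S.H) ((B : S.H →L[ℂ] S.H) x) := fun A B x => rfl
  have hinv : ∀ (A : unitary (S.H →L[ℂ] S.H)) (x y : S.H), (A : S.H →L[ℂ] S.H) x = y →
      ((A⁻¹ : unitary (S.H →L[ℂ] S.H)) : S.H →L[ℂ] S.H) y = x := fun A x y h => by
    rw [← h, ← hcoe]; simp
  have hVp : ∀ n : ℤ, ((V ^ n : unitary (S.H →L[ℂ] S.H)) : S.H →L[ℂ] S.H) (b 0) = b (0, n) := by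
    intro n
    induction n using Int.induction_on with
    | zero => simp; rfl
    | succ n ih =>
      rw [add_comm, zpow_one_add, hcoe, ih, hV]
      simp [add_comm]
    | pred n ih =>
      rw [sub_eq_neg_add, zpow_add, zpow_neg_one, hcoe, ih]
      refine hinv _ _ _ ?_
      rw [hV]; simp
  have hUp : ∀ (n : ℤ) (c : ℤ), ((U ^ n : unitary (S.H →L[ℂ] S.H)) : S.H →L[ℂ] S.H) (b (0, c))
      = b (n, c) := by
    intro n c
    induction n using Int.induction_on with
    | zero => simp
    | succ n ih =>
      rw [add_comm, zpow_one_add, hcoe, ih, hU]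
      simp [add_comm]
    | pred n ih =>
      rw [sub_eq_neg_add, zpow_add, zpow_neg_one, hcoe, ih]
      refine hinv _ _ _ ?_
      rw [hU]; simp
  refine ⟨S, U, V, b 0, ⟨b.continuousLinearMap_ext fun i => ?_, hω, b.orthonormal.1 0,
    fun k hk => ?_⟩⟩
  · simp only [mul_apply_eq_comp, smul_apply, hU, hV, map_smul,
      smul_smul]
    rw [add_assoc, add_assoc]
    simp only [Prod.fst_add, Prod.mk_add_mk, add_zero, zero_add]
    congr 1
    rw [neg_add, zpow_add₀ hω0, zpow_neg_one]
    field_simp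
  · rw [vecState, qMono, hcoe, hVp, hUp]
    exact b.orthonormal.2 (Ne.symm hk)

theorem zpow_mul_zpow_of_mul_eq_central {G : Type*} [Group G] {u v z : G} (hz : ∀ g, Commute z g)
    (h : u * v = z * (v * u)) (a b : ℤ) : v ^ b * u ^ a = z ^ (-(b * a)) * (u ^ a * v ^ b) := by
  have h1 : SemiconjBy u v (z * v) := by rw [SemiconjBy, h, mul_assoc]
  have h2 := h1.zpow_right b
  rw [(hz v).mul_zpow, SemiconjBy] at h2
  have h3 : SemiconjBy (v ^ b) u (z ^ (-b) * u) := by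
    rw [SemiconjBy, mul_assoc, h2, zpow_neg]; group
  have h4 := h3.zpow_right a
  rw [((hz u).zpow_left (-b)).mul_zpow, ← zpow_mul, SemiconjBy, mul_assoc] at h4
  rw [h4, neg_mul]

section vecState

variable {H : Type*} [NormedAddCommGroup H] [InnerProductSpace ℂ H]

/-- The vector state as a linear functional. -/
noncomputable def vecStateₗ (e : H) : (H →L[ℂ] H) →ₗ[ℂ] ℂ where
  toFun := vecState e
  map_add' S T := by simp [vecState]
  map_smul' c T := by simp [vecState]

@[simp] theorem vecStateₗ_apply (e : H) (T : H →L[ℂ] H) : vecStateₗ e T = vecState e T := rfl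

theorem norm_vecState_le {e : H} (he : ‖e‖ = 1) (T : H →L[ℂ] H) : ‖vecState e T‖ ≤ ‖T‖ := by
  have h1 := norm_inner_le_norm (𝕜 := ℂ) e (T e)
  have h2 := T.le_opNorm e
  rw [he, mul_one] at h2
  rw [he, one_mul] at h1
  exact h1.trans h2

theorem vecState_one {e : H} (he : ‖e‖ = 1) : vecState e (1 : H →L[ℂ] H) = 1 := by
  simp [vecState, inner_self_eq_norm_sq_to_K, he]

theorem re_vecState_mono (e : H) {S T : H →L[ℂ] H} (h : S ≤ T) :
    (vecState e S).re ≤ (vecState e T).re := by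
  have h1 := ((ContinuousLinearMap.le_def S T).1 h).re_inner_nonneg_right e
  have h2 : @inner ℂ H _ e ((T - S) e) = vecState e T - vecState e S := by
    simp [vecState]
  rw [h2] at h1
  simpa using h1

end vecState

section monomials

variable {H : Type*} [NormedAddCommGroup H] [InnerProductSpace ℂ H] [CompleteSpace H]
  {U V : unitary (H →L[ℂ] H)} {ω : ℂ} {e : H}

theorem norm_qMono_le (U V : unitary (H →L[ℂ] H)) (k : ℤ × ℤ) : ‖qMono U V k‖ ≤ 1 := by
  refine ContinuousLinearMap.opNorm_le_bound _ zero_le_one fun x => ?_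
  rw [one_mul, qMono, ← Unitary.coe_linearIsometryEquiv_apply]
  exact (LinearIsometryEquiv.norm_map _ x).le

theorem qMono_zero (U V : unitary (H →L[ℂ] H)) : qMono U V 0 = 1 := by simp [qMono]

theorem star_qMono_mul_self (U V : unitary (H →L[ℂ] H)) (k : ℤ × ℤ) :
    star (qMono U V k) * qMono U V k = 1 := by
  rw [qMono]; exact Unitary.coe_star_mul_self _

theorem qMono_mul_star_self (U V : unitary (H →L[ℂ] H)) (k : ℤ × ℤ) :
    qMono U V k * star (qMono U V k) = 1 := by
  rw [qMono]; exact Unitary.coe_mul_star_self _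

/-- The span of the monomials with exponent in `s`. -/
def monoSpan (U V : unitary (H →L[ℂ] H)) (s : Set (ℤ × ℤ)) : Submodule ℂ (H →L[ℂ] H) :=
  Submodule.span ℂ (qMono U V '' s)

theorem qMono_mem_monoSpan {s : Set (ℤ × ℤ)} {k : ℤ × ℤ} (hk : k ∈ s) :
    qMono U V k ∈ monoSpan U V s :=
  Submodule.subset_span ⟨k, hk, rfl⟩

theorem monoSpan_mono {s t : Set (ℤ × ℤ)} (h : s ⊆ t) : monoSpan U V s ≤ monoSpan U V t :=
  Submodule.span_mono (Set.image_mono h)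

theorem one_mem_monoSpan {s : Set (ℤ × ℤ)} (hs : (0 : ℤ × ℤ) ∈ s) :
    (1 : H →L[ℂ] H) ∈ monoSpan U V s := by
  rw [← qMono_zero U V]; exact qMono_mem_monoSpan hs

theorem exists_linearMap_qFourier (e : H) (U V : unitary (H →L[ℂ] H)) (k : ℤ × ℤ) :
    ∃ f : (H →L[ℂ] H) →ₗ[ℂ] ℂ, ∀ T, f T = qFourier e U V T k :=
  ⟨vecStateₗ e ∘ₗ LinearMap.mulLeft ℂ (star (qMono U V k)), fun _ => rfl⟩

namespace IsTraceVector

theorem phase_ne_zero (h : IsTraceVector U V ω e) : ω ≠ 0 := fun h0 => by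
  simpa [h0] using h.norm_phase

theorem norm_phase_zpow (h : IsTraceVector U V ω e) (n : ℤ) : ‖ω ^ n‖ = 1 := by
  rw [norm_zpow, h.norm_phase, one_zpow]

theorem coe_zpow_mul_zpow (h : IsTraceVector U V ω e) (a b : ℤ) :
    ((V ^ b * U ^ a : unitary (H →L[ℂ] H)) : H →L[ℂ] H)
      = ω ^ (-(b * a)) • ((U ^ a * V ^ b : unitary (H →L[ℂ] H)) : H →L[ℂ] H) := by
  have hz0 : star ω * ω = 1 := by
    rw [Complex.star_def, Complex.conj_mul', h.norm_phase]; simp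
  let z : unitary (H →L[ℂ] H) := ⟨ω • 1, by
    rw [Unitary.mem_iff]
    constructor
    · rw [star_smul, star_one, smul_mul_smul_comm, hz0, one_mul, one_smul]
    · rw [star_smul, star_one, smul_mul_smul_comm, mul_comm, hz0, one_mul, one_smul]⟩
  have hzc : ∀ g, Commute z g := fun g => Subtype.ext (by simp [z])
  have hzp : ∀ n : ℤ, ((z ^ n : unitary (H →L[ℂ] H)) : H →L[ℂ] H) = ω ^ n • 1 := by
    have key : ∀ n : ℤ, ((z ^ n : unitary (H →L[ℂ] H)) : H →L[ℂ] H) * (ω ^ (-n) • 1) = 1 := by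
      intro n
      induction n using Int.induction_on with
      | zero => simp
      | succ n ih =>
        rw [zpow_add_one, Submonoid.coe_mul, neg_add, zpow_add₀ h.phase_ne_zero]
        simpa [z, smul_smul, h.phase_ne_zero] using ih
      | pred n ih =>
        have : ((z ^ (-(n : ℤ)) : unitary (H →L[ℂ] H)) : H →L[ℂ] H)
            = ((z ^ (-(n : ℤ) - 1) : unitary (H →L[ℂ] H)) : H →L[ℂ] H) * (ω • 1) := by
          have : z ^ (-(n : ℤ)) = z ^ (-(n : ℤ) - 1) * z := by
            rw [← zpow_add_one]; congr 1; ring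
          rw [this]; rfl
        rw [this] at ih
        rw [neg_sub, sub_neg_eq_add, add_comm, zpow_add₀ h.phase_ne_zero, zpow_natCast]
        simpa [smul_smul, mul_comm] using ih
    intro n
    have h2 := congrArg (fun T => T * (ω ^ n • (1 : H →L[ℂ] H))) (key n)
    simpa [smul_smul, mul_inv_cancel₀ (zpow_ne_zero n h.phase_ne_zero)] using h2
  have hc : U * V = z * (V * U) := Subtype.ext (by simp [z, h.comm])
  rw [zpow_mul_zpow_of_mul_eq_central hzc hc, Submonoid.coe_mul, hzp, smul_one_mul]

theorem qMono_mul (h : IsTraceVector U V ω e) (k l : ℤ × ℤ) :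
    qMono U V k * qMono U V l = ω ^ (-(k.2 * l.1)) • qMono U V (k + l) := by
  have h1 : qMono U V k * qMono U V l = ((U ^ k.1 : unitary (H →L[ℂ] H)) : H →L[ℂ] H) *
      ((V ^ k.2 * U ^ l.1 : unitary (H →L[ℂ] H)) : H →L[ℂ] H) *
        ((V ^ l.2 : unitary (H →L[ℂ] H)) : H →L[ℂ] H) := by
    simp only [qMono, Submonoid.coe_mul, mul_assoc]
  rw [h1, h.coe_zpow_mul_zpow, mul_smul_comm, smul_mul_assoc]
  simp only [qMono, ← Submonoid.coe_mul, Prod.fst_add, Prod.snd_add, zpow_add, mul_assoc]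

theorem star_qMono (h : IsTraceVector U V ω e) (k : ℤ × ℤ) :
    star (qMono U V k) = ω ^ (-(k.1 * k.2)) • qMono U V (-k) := by
  have h1 : qMono U V (-k) * qMono U V k = ω ^ (k.1 * k.2) • 1 := by
    rw [h.qMono_mul, neg_add_cancel, qMono_zero]
    congr 2
    simp only [Prod.snd_neg]; ring
  have h2 := congrArg (fun T => ω ^ (-(k.1 * k.2)) • (T * star (qMono U V k))) h1
  simp only [mul_assoc, qMono_mul_star_self, mul_one, smul_mul_assoc, one_mul, smul_smul] at h2
  rw [h2, ← zpow_add₀ h.phase_ne_zero]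
  simp

theorem qFourier_qMono (h : IsTraceVector U V ω e) (l k : ℤ × ℤ) :
    qFourier e U V (qMono U V l) k = if l = k then 1 else 0 := by
  split_ifs with hlk
  · rw [hlk, qFourier, star_qMono_mul_self, vecState_one h.norm_vec]
  · rw [qFourier, h.star_qMono, smul_mul_assoc, h.qMono_mul, smul_smul, ← vecStateₗ_apply, map_smul,
      vecStateₗ_apply, h.vecState_qMono, smul_zero]
    intro h0
    exact hlk (by rw [neg_add_eq_zero] at h0; exact h0.symm)

theorem norm_qFourier_le (h : IsTraceVector U V ω e) (T : H →L[ℂ] H) (k : ℤ × ℤ) :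
    ‖qFourier e U V T k‖ ≤ ‖T‖ := by
  refine (norm_vecState_le h.norm_vec _).trans ((norm_mul_le _ _).trans ?_)
  rw [norm_star]
  exact mul_le_of_le_one_left (norm_nonneg _) (norm_qMono_le U V k)

theorem mul_mem_monoSpan (h : IsTraceVector U V ω e) {s t r : Set (ℤ × ℤ)}
    (hr : ∀ k ∈ s, ∀ l ∈ t, k + l ∈ r)
    {X Y : H →L[ℂ] H} (hX : X ∈ monoSpan U V s) (hY : Y ∈ monoSpan U V t) :
    X * Y ∈ monoSpan U V r := by
  have h1 := Submodule.mul_mem_mul hX hY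
  rw [monoSpan, monoSpan, Submodule.span_mul_span] at h1
  refine Submodule.span_le.2 ?_ h1
  rintro _ ⟨_, ⟨k, hk, rfl⟩, _, ⟨l, hl, rfl⟩, rfl⟩
  simp only [h.qMono_mul]
  exact Submodule.smul_mem _ _ (qMono_mem_monoSpan (hr k hk l hl))

theorem vecState_eq_zero (h : IsTraceVector U V ω e) {s : Set (ℤ × ℤ)} (hs : (0 : ℤ × ℤ) ∉ s)
    {X : H →L[ℂ] H}
    (hX : X ∈ monoSpan U V s) : vecState e X = 0 := by
  have : monoSpan U V s ≤ LinearMap.ker (vecStateₗ e) := by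
    refine Submodule.span_le.2 ?_
    rintro _ ⟨k, hk, rfl⟩
    exact h.vecState_qMono k fun h0 => hs (h0 ▸ hk)
  exact this hX

theorem qFourier_eq_zero (h : IsTraceVector U V ω e) {s : Set (ℤ × ℤ)} {k : ℤ × ℤ} (hk : k ∉ s)
    {X : H →L[ℂ] H}
    (hX : X ∈ monoSpan U V s) : qFourier e U V X k = 0 := by
  obtain ⟨f, hf⟩ := exists_linearMap_qFourier e U V k
  have : monoSpan U V s ≤ LinearMap.ker f := by
    refine Submodule.span_le.2 ?_
    rintro _ ⟨l, hl, rfl⟩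
    simp only [SetLike.mem_coe, LinearMap.mem_ker]
    rw [hf, h.qFourier_qMono, if_neg]
    exact fun h0 => hk (h0 ▸ hl)
  rw [← hf]
  exact this hX

theorem eq_sum_qFourier (h : IsTraceVector U V ω e) {s : Finset (ℤ × ℤ)} {X : H →L[ℂ] H}
    (hX : X ∈ monoSpan U V s) :
    X = ∑ k ∈ s, qFourier e U V X k • qMono U V k := by
  choose f hf using exists_linearMap_qFourier e U V
  have : monoSpan U V s ≤ LinearMap.eqLocus LinearMap.id
      (∑ k ∈ s, (f k).smulRight (qMono U V k)) := by
    refine Submodule.span_le.2 ?_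
    rintro _ ⟨l, hl, rfl⟩
    simp only [SetLike.mem_coe, LinearMap.mem_eqLocus, LinearMap.id_apply, LinearMap.sum_apply,
      LinearMap.smulRight_apply, hf, h.qFourier_qMono, ite_smul, one_smul, zero_smul]
    rw [Finset.sum_ite_eq, if_pos (by simpa using hl)]
  have h2 := this hX
  simpa [LinearMap.sum_apply, hf] using h2

end IsTraceVector

end monomials

section spectrum

/-- The spectrum of the Riesz product `P_j`. -/
def rieszSpectrum (m : ℕ → ℕ) (j : ℕ) : Finset (ℤ × ℤ) :=
  Finset.image (fun ξ : Fin j → Fin 3 =>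
    ∑ l : Fin j, (((ξ l : ℕ) : ℤ) - 1) • baseVec m ((l : ℕ) + 1)) Finset.univ

theorem mem_rieszSpectrum {m : ℕ → ℕ} {j : ℕ} {y : ℤ × ℤ} : y ∈ rieszSpectrum m j ↔
    ∃ ξ : Fin j → Fin 3, ∑ l : Fin j, (((ξ l : ℕ) : ℤ) - 1) • baseVec m ((l : ℕ) + 1) = y := by
  simp [rieszSpectrum]

theorem mem_Mset {m : ℕ → ℕ} {j : ℕ} {k : ℤ × ℤ} :
    k ∈ Mset m j ↔ ∃ y ∈ rieszSpectrum m (j - 1), baseVec m j + y = k := by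
  simp [Mset, rieszSpectrum]

theorem card_Mset_le (m : ℕ → ℕ) (j : ℕ) : (Mset m j).card ≤ 3 ^ (j - 1) := by
  refine Finset.card_image_le.trans ?_
  simp

theorem neg_mem_rieszSpectrum {m : ℕ → ℕ} {j : ℕ} {y : ℤ × ℤ} (hy : y ∈ rieszSpectrum m j) :
    -y ∈ rieszSpectrum m j := by
  obtain ⟨ξ, rfl⟩ := mem_rieszSpectrum.1 hy
  refine mem_rieszSpectrum.2 ⟨fun l => (ξ l).rev, ?_⟩
  rw [← Finset.sum_neg_distrib]
  refine Finset.sum_congr rfl fun l _ => ?_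
  rw [← neg_smul]
  congr 1
  have := (ξ l).isLt
  rw [Fin.val_rev]
  omega

theorem add_smul_mem_rieszSpectrum {m : ℕ → ℕ} {j : ℕ} {y : ℤ × ℤ} (hy : y ∈ rieszSpectrum m j)
    (s : Fin 3) : y + (((s : ℕ) : ℤ) - 1) • baseVec m (j + 1) ∈ rieszSpectrum m (j + 1) := by
  obtain ⟨ξ, rfl⟩ := mem_rieszSpectrum.1 hy
  refine mem_rieszSpectrum.2 ⟨Fin.snoc (α := fun _ => Fin 3) ξ s, ?_⟩
  rw [Fin.sum_univ_castSucc]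
  simp

theorem zero_mem_rieszSpectrum_zero (m : ℕ → ℕ) : (0 : ℤ × ℤ) ∈ rieszSpectrum m 0 :=
  mem_rieszSpectrum.2 ⟨fun _ => 0, by simp⟩

theorem rieszSpectrum_subset_succ (m : ℕ → ℕ) (j : ℕ) :
    rieszSpectrum m j ⊆ rieszSpectrum m (j + 1) := fun y hy => by
  simpa using add_smul_mem_rieszSpectrum hy 1

/-- The sum `m_1 + ⋯ + m_j`. -/
def partialSum (m : ℕ → ℕ) (j : ℕ) : ℤ := ∑ l ∈ Finset.range j, (m (l + 1) : ℤ)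

theorem partialSum_succ (m : ℕ → ℕ) (j : ℕ) :
    partialSum m (j + 1) = partialSum m j + m (j + 1) := Finset.sum_range_succ _ _

theorem partialSum_nonneg (m : ℕ → ℕ) (j : ℕ) : 0 ≤ partialSum m j :=
  Finset.sum_nonneg fun _ _ => by positivity

theorem mul_partialSum_le {m : ℕ → ℕ} {L : ℕ} (hL : ∀ j, L * m j ≤ m (j + 1)) (j : ℕ) :
    ((L : ℤ) - 1) * partialSum m j ≤ m (j + 1) := by
  induction j with
  | zero => simp [partialSum]
  | succ j ih =>
    have h1 : ((L : ℤ) * m (j + 1)) ≤ m (j + 1 + 1) := by exact_mod_cast hL (j + 1)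
    rw [partialSum_succ]
    linarith

theorem abs_le_partialSum {m : ℕ → ℕ} {j : ℕ} {y : ℤ × ℤ} (hy : y ∈ rieszSpectrum m j) :
    |y.1| ≤ partialSum m j ∧ |y.2| ≤ partialSum m j := by
  obtain ⟨ξ, rfl⟩ := mem_rieszSpectrum.1 hy
  have hξ : ∀ l, |((ξ l : ℕ) : ℤ) - 1| ≤ 1 := fun l => by
    have := (ξ l).isLt
    rw [abs_le]; omega
  have hR : partialSum m j = ∑ l : Fin j, (m ((l : ℕ) + 1) : ℤ) :=
    (Fin.sum_univ_eq_sum_range (fun l => (m (l + 1) : ℤ)) j).symm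
  rw [Prod.fst_sum, Prod.snd_sum, hR]
  constructor <;>
  · refine (Finset.abs_sum_le_sum_abs _ _).trans (Finset.sum_le_sum fun l _ => ?_)
    simp only [baseVec, Prod.smul_mk, smul_eq_mul, abs_mul, abs_pow, abs_neg, abs_one, one_pow,
      one_mul, Nat.abs_cast]
    exact mul_le_of_le_one_left (by positivity) (hξ l)

theorem abs_coord_ratio_le {m : ℕ → ℕ} {L j : ℕ} (hL9 : 9 ≤ L) (hL : ∀ j, L * m j ≤ m (j + 1))
    (hm : ∀ j, 1 ≤ m j) (hj : 1 ≤ j) {k : ℤ × ℤ} (hk : k ∈ Mset m j) :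
    |(k.1 : ℝ) / k.2 - (-1) ^ (j - 1)| ≤ 4 / ((L : ℝ) - 1) := by
  obtain ⟨y, hy, rfl⟩ := mem_Mset.1 hk
  obtain ⟨j, rfl⟩ := Nat.exists_eq_add_of_le' hj
  simp only [Nat.add_sub_cancel] at hy ⊢
  obtain ⟨h1, h2⟩ := abs_le_partialSum hy
  have h3 : ((L : ℝ) - 1) * (partialSum m j : ℝ) ≤ m (j + 1) := by
    exact_mod_cast mul_partialSum_le hL j
  have h1' : |(y.1 : ℝ)| ≤ partialSum m j := by exact_mod_cast h1
  have h2' : |(y.2 : ℝ)| ≤ partialSum m j := by exact_mod_cast h2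
  have hL' : (9 : ℝ) ≤ L := by exact_mod_cast hL9
  have hm' : (1 : ℝ) ≤ m (j + 1) := by exact_mod_cast hm (j + 1)
  have hR : (0 : ℝ) ≤ partialSum m j := by exact_mod_cast partialSum_nonneg m j
  generalize hr : (partialSum m j : ℝ) = r at *
  generalize hM : (m (j + 1) : ℝ) = M at *
  have hs : |(-1 : ℝ) ^ j| = 1 := by simp
  have hss : ((-1 : ℝ) ^ j) * (-1) ^ j = 1 := by rw [← mul_pow]; simp
  simp only [baseVec, Prod.fst_add, Prod.snd_add, Nat.add_sub_cancel]
  push_cast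
  rw [hM]
  have hy2 := abs_le.1 h2'
  have hk2 : M / 2 ≤ M + y.2 := by nlinarith
  have hpos : 0 < M + (y.2 : ℝ) := by linarith
  have key : ((-1) ^ j * M + (y.1 : ℝ)) / (M + y.2) - (-1) ^ j
      = (y.1 - (-1) ^ j * y.2) / (M + y.2) := by
    field_simp; ring
  rw [key, abs_div, abs_of_pos hpos, div_le_div_iff₀ hpos (by linarith)]
  have h4 : |(y.1 : ℝ) - (-1) ^ j * y.2| ≤ 2 * r := by
    refine (abs_sub _ _).trans ?_
    rw [abs_mul, hs]; linarith
  nlinarith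

end spectrum

theorem partialSum_lt_snd {m : ℕ → ℕ} {L j : ℕ} (hL9 : 9 ≤ L) (hL : ∀ j, L * m j ≤ m (j + 1))
    (hm : ∀ j, 1 ≤ m j) {k : ℤ × ℤ} (hk : k ∈ Mset m (j + 1)) : partialSum m j < k.2 := by
  obtain ⟨y, hy, rfl⟩ := mem_Mset.1 hk
  have h1 := abs_le.1 (abs_le_partialSum hy).2
  have h2 := mul_partialSum_le hL j
  have h3 : (1 : ℤ) ≤ m (j + 1) := by exact_mod_cast hm (j + 1)
  have h4 := partialSum_nonneg m j
  have h5 : (9 : ℤ) ≤ L := by exact_mod_cast hL9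
  simp only [Nat.add_sub_cancel] at h1
  simp only [baseVec, Prod.snd_add]
  nlinarith

section rieszProduct

variable {H : Type*} [NormedAddCommGroup H] [InnerProductSpace ℂ H] [CompleteSpace H]
  {U V : unitary (H →L[ℂ] H)} {ω : ℂ} {e : H}

/-- The non-commutative cosine `(u_j + u_j^*) / 2` with `u_j = U^{(−1)^{j−1} m_j} V^{m_j}`. -/
noncomputable def rieszCos (U V : unitary (H →L[ℂ] H)) (m : ℕ → ℕ) (j : ℕ) : H →L[ℂ] H :=
  (2⁻¹ : ℂ) • (qMono U V (baseVec m j) + star (qMono U V (baseVec m j)))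

theorem rieszFactor_eq (U V : unitary (H →L[ℂ] H)) (m : ℕ → ℕ) (j : ℕ) :
    rieszFactor U V m j = 1 + rieszCos U V m j := by
  have : star (qMono U V (baseVec m j)) = ((V ^ (-(m j : ℤ)) *
      U ^ (-((-1 : ℤ) ^ (j - 1) * (m j : ℤ))) : unitary (H →L[ℂ] H)) : H →L[ℂ] H) := by
    rw [qMono, ← Unitary.coe_star, Unitary.star_eq_inv, mul_inv_rev, zpow_neg, zpow_neg]
    rfl
  rw [rieszFactor, rieszCos, this]
  rfl

theorem star_rieszCos (U V : unitary (H →L[ℂ] H)) (m : ℕ → ℕ) (j : ℕ) :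
    star (rieszCos U V m j) = rieszCos U V m j := by
  simp [rieszCos, star_smul, add_comm]

theorem norm_rieszCos_le (U V : unitary (H →L[ℂ] H)) (m : ℕ → ℕ) (j : ℕ) :
    ‖rieszCos U V m j‖ ≤ 1 := by
  rw [rieszCos, norm_smul]
  have h1 := norm_add_le (qMono U V (baseVec m j)) (star (qMono U V (baseVec m j)))
  rw [norm_star] at h1
  have h2 := norm_qMono_le U V (baseVec m j)
  norm_num
  linarith

theorem rieszProd_succ (U V : unitary (H →L[ℂ] H)) (m : ℕ → ℕ) (j : ℕ) :
    rieszProd U V m (j + 1) = rieszProd U V m j + rieszCos U V m (j + 1) * rieszProd U V m j := by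
  rw [rieszProd, rieszFactor_eq, add_mul, one_mul]

theorem norm_rieszProd_le (U V : unitary (H →L[ℂ] H)) (m : ℕ → ℕ) (j : ℕ) :
    ‖rieszProd U V m j‖ ≤ 2 ^ j := by
  induction j with
  | zero => simpa [rieszProd, qMono_zero] using norm_qMono_le U V 0
  | succ j ih =>
    rw [rieszProd_succ, pow_succ]
    have h1 := norm_add_le (rieszProd U V m j) (rieszCos U V m (j + 1) * rieszProd U V m j)
    have h2 := norm_mul_le (rieszCos U V m (j + 1)) (rieszProd U V m j)
    have h3 := mul_le_of_le_one_left (norm_nonneg (rieszProd U V m j))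
      (norm_rieszCos_le U V m (j + 1))
    linarith

theorem kCoord_neg (a : ℕ) (k : ℤ × ℤ) : kCoord a (-k) = -kCoord a k := by
  unfold kCoord; split_ifs <;> rfl

theorem derivW_eq (e : H) (U V : unitary (H →L[ℂ] H)) (m : ℕ → ℕ) (N a b : ℕ) :
    derivW e U V m N a b = ∑ j ∈ Finset.Icc 1 N, ∑ k ∈ Mset m j,
      ((kCoord a k : ℂ) * kCoord b k / (k.2 : ℂ) ^ 2) •
        (qFourier e U V (rieszProd U V m N) k • qMono U V k
          + qFourier e U V (rieszProd U V m N) (-k) • qMono U V (-k)) := by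
  have hπ : (π : ℂ) ≠ 0 := by exact_mod_cast Real.pi_ne_zero
  rw [derivW, Finset.smul_sum]
  refine Finset.sum_congr rfl fun j _ => ?_
  rw [Finset.smul_sum]
  refine Finset.sum_congr rfl fun k _ => ?_
  have key : ∀ x y q : ℂ, -(1 / (4 * (π : ℂ) ^ 2)) * (((k.2 : ℂ) ^ 2)⁻¹ *
      ((2 * (π : ℂ) * Complex.I * x) * (2 * (π : ℂ) * Complex.I * y)) * q)
      = x * y / (k.2 : ℂ) ^ 2 * q := by
    intro x y q
    have hI : Complex.I * Complex.I = -1 := Complex.I_mul_I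
    field_simp
    linear_combination (-4 * x * y * q / (k.2 : ℂ) ^ 2) * hI
  rw [smul_add, smul_add, smul_smul, smul_smul, smul_smul, smul_smul, key, key, kCoord_neg,
    kCoord_neg]
  push_cast
  rw [neg_mul_neg]

namespace IsTraceVector

theorem star_qMono_mem_monoSpan (h : IsTraceVector U V ω e) (k : ℤ × ℤ) :
    star (qMono U V k) ∈ monoSpan U V {-k} := by
  rw [h.star_qMono]
  exact Submodule.smul_mem _ _ (qMono_mem_monoSpan rfl)

theorem rieszCos_mem_monoSpan (h : IsTraceVector U V ω e) (m : ℕ → ℕ) (j : ℕ) :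
    rieszCos U V m j ∈ monoSpan U V {baseVec m j, -baseVec m j} := by
  refine Submodule.smul_mem _ _ (Submodule.add_mem _ (qMono_mem_monoSpan (by simp)) ?_)
  exact monoSpan_mono (by simp) (h.star_qMono_mem_monoSpan _)

theorem rieszProd_mem_monoSpan (h : IsTraceVector U V ω e) (m : ℕ → ℕ) (j : ℕ) :
    rieszProd U V m j ∈ monoSpan U V (rieszSpectrum m j) := by
  induction j with
  | zero => exact one_mem_monoSpan (by exact_mod_cast zero_mem_rieszSpectrum_zero m)
  | succ j ih =>
    rw [rieszProd_succ]
    refine Submodule.add_mem _ (monoSpan_mono (by exact_mod_cast rieszSpectrum_subset_succ m j) ih)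
      (h.mul_mem_monoSpan ?_ (h.rieszCos_mem_monoSpan m (j + 1)) ih)
    rintro k hk l hl
    rw [Finset.mem_coe] at hl ⊢
    rcases hk with rfl | rfl
    · simpa [add_comm] using add_smul_mem_rieszSpectrum hl 2
    · simpa [add_comm] using add_smul_mem_rieszSpectrum hl 0

theorem rieszCos_mul_mem_monoSpan (h : IsTraceVector U V ω e) (m : ℕ → ℕ) (j : ℕ) :
    rieszCos U V m (j + 1) * rieszProd U V m j
      ∈ monoSpan U V ↑(Mset m (j + 1) ∪ (Mset m (j + 1)).image Neg.neg) := by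
  refine h.mul_mem_monoSpan ?_ (h.rieszCos_mem_monoSpan m (j + 1)) (h.rieszProd_mem_monoSpan m j)
  rintro k hk l hl
  rw [Finset.mem_coe] at hl ⊢
  rw [Finset.mem_union, Finset.mem_image]
  rcases hk with rfl | rfl
  · exact Or.inl (mem_Mset.2 ⟨l, hl, rfl⟩)
  · refine Or.inr ⟨baseVec m (j + 1) + -l, mem_Mset.2 ⟨-l, neg_mem_rieszSpectrum hl, rfl⟩, ?_⟩
    rw [neg_add, neg_neg]

variable {m : ℕ → ℕ} {L : ℕ}

theorem qFourier_rieszProd (h : IsTraceVector U V ω e) (hL9 : 9 ≤ L)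
    (hL : ∀ j, L * m j ≤ m (j + 1)) (hm : ∀ j, 1 ≤ m j) {j N : ℕ} (hjN : j + 1 ≤ N) {k : ℤ × ℤ}
    (hk : k ∈ Mset m (j + 1) ∪ (Mset m (j + 1)).image Neg.neg) :
    qFourier e U V (rieszProd U V m N) k
      = qFourier e U V (rieszCos U V m (j + 1) * rieszProd U V m j) k := by
  have hlow : ∀ {i : ℕ} {k : ℤ × ℤ}, k ∈ Mset m (i + 1) ∪ (Mset m (i + 1)).image Neg.neg →
      partialSum m i < |k.2| := by
    intro i k hk
    rw [Finset.mem_union, Finset.mem_image] at hk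
    rcases hk with hk | ⟨l, hl, rfl⟩
    · exact (partialSum_lt_snd hL9 hL hm hk).trans_le (le_abs_self _)
    · refine (partialSum_lt_snd hL9 hL hm hl).trans_le ?_
      rw [Prod.snd_neg, abs_neg]; exact le_abs_self _
  have hup : k ∈ rieszSpectrum m (j + 1) := by
    rw [Finset.mem_union, Finset.mem_image] at hk
    have key : ∀ k ∈ Mset m (j + 1), k ∈ rieszSpectrum m (j + 1) := by
      intro k hk
      obtain ⟨y, hy, rfl⟩ := mem_Mset.1 hk
      simpa [add_comm] using add_smul_mem_rieszSpectrum hy 2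
    rcases hk with hk | ⟨l, hl, rfl⟩
    · exact key k hk
    · exact neg_mem_rieszSpectrum (key l hl)
  have hadd : ∀ X Y : H →L[ℂ] H, qFourier e U V (X + Y) k = qFourier e U V X k
      + qFourier e U V Y k := fun X Y => by
    obtain ⟨f, hf⟩ := exists_linearMap_qFourier e U V k
    simp only [← hf, map_add]
  induction N, hjN using Nat.le_induction with
  | base =>
    rw [rieszProd_succ, hadd, h.qFourier_eq_zero _ (h.rieszProd_mem_monoSpan m j), zero_add]
    exact fun h0 => absurd (abs_le_partialSum h0).2 (not_le.2 (hlow hk))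
  | succ N hN ih =>
    have hmono : ∀ i, rieszSpectrum m (j + 1) ⊆ rieszSpectrum m (j + 1 + i) := by
      intro i
      induction i with
      | zero => exact subset_rfl
      | succ i ih => exact ih.trans (rieszSpectrum_subset_succ m _)
    obtain ⟨i, rfl⟩ := Nat.exists_eq_add_of_le hN
    rw [rieszProd_succ, hadd, ih,
      h.qFourier_eq_zero _ (h.rieszCos_mul_mem_monoSpan m (j + 1 + i)), add_zero]
    exact fun h0 => absurd (abs_le_partialSum (hmono i hup)).2 (not_le.2 (hlow h0))

theorem rieszCos_mul_eq_sum (h : IsTraceVector U V ω e) (hL9 : 9 ≤ L)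
    (hL : ∀ j, L * m j ≤ m (j + 1)) (hm : ∀ j, 1 ≤ m j) {j N : ℕ} (hjN : j + 1 ≤ N) :
    rieszCos U V m (j + 1) * rieszProd U V m j = ∑ k ∈ Mset m (j + 1),
      (qFourier e U V (rieszProd U V m N) k • qMono U V k
          + qFourier e U V (rieszProd U V m N) (-k) • qMono U V (-k)) := by
  have h1 := h.eq_sum_qFourier (h.rieszCos_mul_mem_monoSpan m j)
  rw [h1, Finset.sum_union, Finset.sum_image (fun _ _ _ _ h => neg_injective h),
    ← Finset.sum_add_distrib]
  · refine Finset.sum_congr rfl fun k hk => ?_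
    rw [h.qFourier_rieszProd hL9 hL hm hjN (Finset.mem_union_left _ hk),
      h.qFourier_rieszProd hL9 hL hm hjN
        (Finset.mem_union_right _ (Finset.mem_image_of_mem _ hk))]
  · rw [Finset.disjoint_left]
    intro k hk hk'
    obtain ⟨l, hl, rfl⟩ := Finset.mem_image.1 hk'
    have h2 := partialSum_lt_snd hL9 hL hm hk
    have h3 := partialSum_lt_snd hL9 hL hm hl
    have h4 := partialSum_nonneg m j
    rw [Prod.snd_neg] at h2
    omega

/-- A derivative of `W_N` is close to a combination of the increments of the Riesz product. -/
theorem norm_derivW_sub_le (h : IsTraceVector U V ω e) (hL9 : 9 ≤ L)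
    (hL : ∀ j, L * m j ≤ m (j + 1)) (hm : ∀ j, 1 ≤ m j) (N a b : ℕ) (s : ℕ → ℝ) {δ : ℝ}
    (hδ : ∀ j, ∀ k ∈ Mset m (j + 1), |(kCoord a k : ℝ) * kCoord b k / (k.2 : ℝ) ^ 2 - s j| ≤ δ) :
    ‖derivW e U V m N a b
        - ∑ j ∈ Finset.range N, (s j : ℂ) • (rieszCos U V m (j + 1) * rieszProd U V m j)‖
      ≤ N * (3 ^ N * (δ * (2 * 2 ^ N))) := by
  have hδ0 : 0 ≤ δ := by
    have h0 : baseVec m 1 + 0 ∈ Mset m (0 + 1) :=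
      mem_Mset.2 ⟨0, zero_mem_rieszSpectrum_zero m, rfl⟩
    exact (abs_nonneg _).trans (hδ 0 _ h0)
  rw [derivW_eq, Finset.range_eq_Ico, ← Finset.Ico_add_one_right_eq_Icc,
    ← Finset.sum_Ico_add' _ 0 N 1, ← Finset.sum_sub_distrib]
  refine (norm_sum_le_of_le (f := _) _ (fun j hj => (?_ : _ ≤ 3 ^ N * (δ * (2 * 2 ^ N))))).trans ?_
  · have hjN : j + 1 ≤ N := by simpa using hj
    rw [h.rieszCos_mul_eq_sum hL9 hL hm hjN, Finset.smul_sum, ← Finset.sum_sub_distrib]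
    refine (norm_sum_le_of_le _ (fun k hk => (?_ : _ ≤ δ * (2 * 2 ^ N)))).trans ?_
    · rw [← sub_smul, norm_smul]
      refine mul_le_mul ?_ ?_ (norm_nonneg _) hδ0
      · have h1 := hδ j k hk
        rw [← Real.norm_eq_abs, ← Complex.norm_real] at h1
        simpa using h1
      · have h2 : ∀ l, ‖qFourier e U V (rieszProd U V m N) l • qMono U V l‖ ≤ 2 ^ N := fun l => by
          rw [norm_smul]
          calc _ ≤ (2 : ℝ) ^ N * 1 := mul_le_mul ((h.norm_qFourier_le _ l).trans
                (norm_rieszProd_le U V m N)) (norm_qMono_le U V l) (norm_nonneg _) (by positivity)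
            _ = _ := mul_one _
        refine (norm_add_le _ _).trans ?_
        linarith [h2 k, h2 (-k)]
    · rw [Finset.sum_const, nsmul_eq_mul]
      refine mul_le_mul_of_nonneg_right ?_ (by positivity)
      have h3 : (Mset m (j + 1)).card ≤ 3 ^ N := (card_Mset_le m (j + 1)).trans
        (Nat.pow_le_pow_right (by norm_num) (by omega))
      exact_mod_cast h3
  · rw [Finset.sum_const, nsmul_eq_mul]
    simp

end IsTraceVector

end rieszProduct

section testOperator

variable {H : Type*} [NormedAddCommGroup H] [InnerProductSpace ℂ H] [CompleteSpace H]
  {U V : unitary (H →L[ℂ] H)} {ω : ℂ} {e : H} {m : ℕ → ℕ} {L : ℕ}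

/-- The bounded Riesz product `∏ (1 ± i a cos_j)` against which the mixed derivative is tested. -/
noncomputable def testProd (U V : unitary (H →L[ℂ] H)) (m : ℕ → ℕ) (a : ℝ) : ℕ → H →L[ℂ] H
  | 0 => 1
  | N + 1 => testProd U V m a N * (1 + (Complex.I * ((-1) ^ N * a)) • rieszCos U V m (N + 1))

/-- The alternating sum of the increments of the Riesz product. -/
noncomputable def altSum (U V : unitary (H →L[ℂ] H)) (m : ℕ → ℕ) (N : ℕ) : H →L[ℂ] H :=
  ∑ j ∈ Finset.range N, ((-1) ^ j : ℂ) • (rieszCos U V m (j + 1) * rieszProd U V m j)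

theorem norm_testProd_sq_le [Nontrivial H] (U V : unitary (H →L[ℂ] H)) (m : ℕ → ℕ) (a : ℝ) (N : ℕ) :
    ‖testProd U V m a N‖ ^ 2 ≤ (1 + a ^ 2) ^ N := by
  have hf : ∀ j, ‖1 + (Complex.I * ((-1) ^ j * a)) • rieszCos U V m (j + 1)‖ ^ 2 ≤ 1 + a ^ 2 := by
    intro j
    have hc : star (Complex.I * ((-1) ^ j * (a : ℂ))) = -(Complex.I * ((-1) ^ j * a)) := by
      simp
    have hs : (Complex.I * ((-1) ^ j * (a : ℂ))) * (Complex.I * ((-1) ^ j * a))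
        = -((a : ℂ) ^ 2) := by
      have h1 : ((-1 : ℂ) ^ j) * (-1) ^ j = 1 := by rw [← mul_pow]; simp
      have hI : Complex.I * Complex.I = -1 := Complex.I_mul_I
      linear_combination (a : ℂ) ^ 2 * ((-1) ^ j * (-1) ^ j) * hI - (a : ℂ) ^ 2 * h1
    rw [pow_two, ← CStarRing.norm_star_mul_self, star_add, star_one, star_smul, star_rieszCos, hc]
    have h2 : (1 + -(Complex.I * ((-1) ^ j * (a : ℂ))) • rieszCos U V m (j + 1)) *
        (1 + (Complex.I * ((-1) ^ j * (a : ℂ))) • rieszCos U V m (j + 1))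
        = 1 + ((a : ℂ) ^ 2) • (rieszCos U V m (j + 1) * rieszCos U V m (j + 1)) := by
      rw [add_mul, mul_add, mul_add, smul_mul_smul_comm, neg_mul, hs]
      simp
    rw [h2]
    have h3 := norm_rieszCos_le U V m (j + 1)
    refine (norm_add_le _ _).trans ?_
    rw [norm_one, norm_smul, norm_pow, Complex.norm_real, Real.norm_eq_abs, sq_abs]
    have h4 : ‖rieszCos U V m (j + 1) * rieszCos U V m (j + 1)‖ ≤ 1 :=
      (norm_mul_le _ _).trans (mul_le_one₀ h3 (norm_nonneg _) h3)
    nlinarith [sq_nonneg a]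
  induction N with
  | zero => simp [testProd]
  | succ N ih =>
    rw [testProd, pow_succ (1 + a ^ 2)]
    calc _ ≤ (‖testProd U V m a N‖
          * ‖1 + (Complex.I * ((-1) ^ N * a)) • rieszCos U V m (N + 1)‖) ^ 2 := by
          exact pow_le_pow_left₀ (norm_nonneg _) (norm_mul_le _ _) 2
      _ = ‖testProd U V m a N‖ ^ 2
          * ‖1 + (Complex.I * ((-1) ^ N * a)) • rieszCos U V m (N + 1)‖ ^ 2 := mul_pow _ _ _
      _ ≤ _ := mul_le_mul ih (hf N) (by positivity) (by positivity)

/-- The exponents `k` with `|k₂| ≤ m_1 + ⋯ + m_j`. -/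
def degreeStrip (m : ℕ → ℕ) (j : ℕ) : Set (ℤ × ℤ) := {k | |k.2| ≤ partialSum m j}

theorem degreeStrip_subset_succ (m : ℕ → ℕ) (j : ℕ) : degreeStrip m j ⊆ degreeStrip m (j + 1) := by
  intro k hk
  simp only [degreeStrip, Set.mem_ofPred_eq, partialSum_succ] at hk ⊢
  have : (0 : ℤ) ≤ m (j + 1) := by positivity
  omega

theorem zero_mem_degreeStrip (m : ℕ → ℕ) (j : ℕ) : (0 : ℤ × ℤ) ∈ degreeStrip m j := by
  simpa [degreeStrip] using partialSum_nonneg m j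

namespace IsTraceVector

theorem rieszProd_mem_degreeStrip (h : IsTraceVector U V ω e) (m : ℕ → ℕ) (j : ℕ) :
    rieszProd U V m j ∈ monoSpan U V (degreeStrip m j) :=
  monoSpan_mono (fun _ hk => (abs_le_partialSum hk).2) (h.rieszProd_mem_monoSpan m j)

theorem rieszCos_mul_mem_degreeStrip (h : IsTraceVector U V ω e) {j : ℕ} {X : H →L[ℂ] H}
    (hX : X ∈ monoSpan U V (degreeStrip m j)) :
    rieszCos U V m (j + 1) * X ∈ monoSpan U V (degreeStrip m (j + 1)) := by
  refine h.mul_mem_monoSpan ?_ (h.rieszCos_mem_monoSpan m (j + 1)) hX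
  rintro k hk l hl
  simp only [degreeStrip, Set.mem_ofPred_eq, partialSum_succ, Prod.snd_add] at hl ⊢
  rw [abs_le] at hl ⊢
  rcases hk with rfl | rfl <;> simp only [baseVec, Prod.snd_neg] <;> omega

theorem mul_rieszCos_mem_degreeStrip (h : IsTraceVector U V ω e) {j : ℕ} {X : H →L[ℂ] H}
    (hX : X ∈ monoSpan U V (degreeStrip m j)) :
    X * rieszCos U V m (j + 1) ∈ monoSpan U V (degreeStrip m (j + 1)) := by
  refine h.mul_mem_monoSpan ?_ hX (h.rieszCos_mem_monoSpan m (j + 1))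
  rintro l hl k hk
  simp only [degreeStrip, Set.mem_ofPred_eq, partialSum_succ, Prod.snd_add] at hl ⊢
  rw [abs_le] at hl ⊢
  rcases hk with rfl | rfl <;> simp only [baseVec, Prod.snd_neg] <;> omega

theorem testProd_mem_degreeStrip (h : IsTraceVector U V ω e) (m : ℕ → ℕ) (a : ℝ) (N : ℕ) :
    testProd U V m a N ∈ monoSpan U V (degreeStrip m N) := by
  induction N with
  | zero => exact one_mem_monoSpan (zero_mem_degreeStrip m 0)
  | succ N ih =>
    rw [testProd, mul_add, mul_one, mul_smul_comm]
    exact Submodule.add_mem _ (monoSpan_mono (degreeStrip_subset_succ m N) ih)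
      (Submodule.smul_mem _ _ (h.mul_rieszCos_mem_degreeStrip ih))

theorem altSum_mem_degreeStrip (h : IsTraceVector U V ω e) (m : ℕ → ℕ) (N : ℕ) :
    altSum U V m N ∈ monoSpan U V (degreeStrip m N) := by
  induction N with
  | zero => simp [altSum]
  | succ N ih =>
    rw [altSum, Finset.sum_range_succ]
    exact Submodule.add_mem _ (monoSpan_mono (degreeStrip_subset_succ m N) ih)
      (Submodule.smul_mem _ _ (h.rieszCos_mul_mem_degreeStrip (h.rieszProd_mem_degreeStrip m N)))

/-- A polynomial of degree two in a cosine of high frequency averages to a scalar. -/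
theorem vecState_mul_rieszCos_mul (h : IsTraceVector U V ω e) (hL9 : 9 ≤ L)
    (hL : ∀ j, L * m j ≤ m (j + 1)) (hm : ∀ j, 1 ≤ m j) {j : ℕ} {X Y : H →L[ℂ] H}
    (hX : X ∈ monoSpan U V (degreeStrip m j)) (hY : Y ∈ monoSpan U V (degreeStrip m j)) :
    vecState e (X * rieszCos U V m (j + 1) * Y) = 0 ∧
    vecState e (X * (rieszCos U V m (j + 1) * rieszCos U V m (j + 1)) * Y)
      = 2⁻¹ * vecState e (X * Y) := by
  have hgap : 2 * partialSum m j < m (j + 1) := by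
    have h2 := mul_partialSum_le hL j
    have h3 : (1 : ℤ) ≤ m (j + 1) := by exact_mod_cast hm (j + 1)
    have h4 := partialSum_nonneg m j
    have h5 : (9 : ℤ) ≤ L := by exact_mod_cast hL9
    nlinarith
  have key : ∀ Z ∈ monoSpan U V {k : ℤ × ℤ | (m (j + 1) : ℤ) ≤ |k.2|},
      vecState e (X * Z * Y) = 0 := by
    intro Z hZ
    have h1 : X * Z ∈ monoSpan U V {k : ℤ × ℤ | (m (j + 1) : ℤ) - partialSum m j ≤ |k.2|} := by
      refine h.mul_mem_monoSpan ?_ hX hZ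
      intro k hk l hl
      simp only [degreeStrip, Set.mem_ofPred_eq, Prod.snd_add] at hk hl ⊢
      have := abs_sub_abs_le_abs_add l.2 k.2
      rw [add_comm k.2]; omega
    have h2 : X * Z * Y ∈ monoSpan U V {k : ℤ × ℤ | 0 < |k.2|} := by
      refine h.mul_mem_monoSpan ?_ h1 hY
      intro k hk l hl
      simp only [degreeStrip, Set.mem_ofPred_eq, Prod.snd_add] at hk hl ⊢
      have := abs_sub_abs_le_abs_add k.2 l.2
      omega
    exact h.vecState_eq_zero (by simp) h2
  refine ⟨key _ (monoSpan_mono ?_ (h.rieszCos_mem_monoSpan m (j + 1))), ?_⟩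
  · rintro k (rfl | rfl) <;> simp [baseVec]
  · set u := qMono U V (baseVec m (j + 1)) with hu
    have huu : u * u ∈ monoSpan U V {k : ℤ × ℤ | (m (j + 1) : ℤ) ≤ |k.2|} := by
      refine h.mul_mem_monoSpan ?_ (qMono_mem_monoSpan (Set.mem_singleton _))
        (qMono_mem_monoSpan (Set.mem_singleton _))
      rintro _ rfl _ rfl
      simp only [baseVec, Prod.snd_add, Set.mem_ofPred_eq]
      exact le_trans (by omega) (le_abs_self _)
    have hvv : star u * star u ∈ monoSpan U V {k : ℤ × ℤ | (m (j + 1) : ℤ) ≤ |k.2|} := by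
      refine h.mul_mem_monoSpan ?_ (h.star_qMono_mem_monoSpan _) (h.star_qMono_mem_monoSpan _)
      rintro _ rfl _ rfl
      simp only [baseVec, Prod.snd_add, Prod.snd_neg, Set.mem_ofPred_eq]
      exact le_trans (by omega) (neg_le_abs _)
    have hsq : rieszCos U V m (j + 1) * rieszCos U V m (j + 1)
        = (4⁻¹ : ℂ) • (u * u + star u * star u) + (2⁻¹ : ℂ) • 1 := by
      rw [rieszCos, ← hu, smul_mul_smul_comm, add_mul, mul_add, mul_add, star_qMono_mul_self,
        qMono_mul_star_self]
      module
    have h3 := key _ (Submodule.smul_mem _ (4⁻¹ : ℂ) (Submodule.add_mem _ huu hvv))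
    rw [hsq, mul_add, add_mul, ← vecStateₗ_apply, map_add, vecStateₗ_apply, h3, mul_smul_comm,
      mul_one, smul_mul_assoc, map_smul, zero_add, vecStateₗ_apply, smul_eq_mul]

theorem vecState_testProd_mul_rieszProd (h : IsTraceVector U V ω e) (hL9 : 9 ≤ L)
    (hL : ∀ j, L * m j ≤ m (j + 1)) (hm : ∀ j, 1 ≤ m j) (a : ℝ) (N : ℕ) :
    vecState e (testProd U V m a N * rieszProd U V m N)
      = ∏ j ∈ Finset.range N, (1 + Complex.I * ((-1) ^ j * a) / 2) := by
  induction N with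
  | zero => simp [testProd, rieszProd, vecState_one h.norm_vec]
  | succ N ih =>
    obtain ⟨h1, h2⟩ := h.vecState_mul_rieszCos_mul hL9 hL hm (h.testProd_mem_degreeStrip m a N)
      (h.rieszProd_mem_degreeStrip m N)
    set z : ℂ := Complex.I * ((-1) ^ N * a) with hz
    have h3 : testProd U V m a (N + 1) * rieszProd U V m (N + 1)
        = testProd U V m a N * rieszProd U V m N
          + (1 + z) • (testProd U V m a N * rieszCos U V m (N + 1) * rieszProd U V m N)
          + z • (testProd U V m a N * (rieszCos U V m (N + 1) * rieszCos U V m (N + 1))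
            * rieszProd U V m N) := by
      rw [testProd, rieszProd_succ, ← hz]
      simp only [mul_add, add_mul, mul_one, mul_smul_comm, smul_mul_assoc, mul_assoc]
      module
    rw [h3, ← vecStateₗ_apply, map_add, map_add, map_smul, map_smul]
    simp only [vecStateₗ_apply, h1, h2, smul_eq_mul]
    rw [Finset.prod_range_succ, ← ih]
    ring

theorem vecState_testProd_mul_altSum (h : IsTraceVector U V ω e) (hL9 : 9 ≤ L)
    (hL : ∀ j, L * m j ≤ m (j + 1)) (hm : ∀ j, 1 ≤ m j) (a : ℝ) (N : ℕ) :
    vecState e (testProd U V m a N * altSum U V m N) = ∑ n ∈ Finset.range N,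
      Complex.I * a / 2 * ∏ j ∈ Finset.range n, (1 + Complex.I * ((-1) ^ j * a) / 2) := by
  induction N with
  | zero => simp [altSum, vecState]
  | succ N ih =>
    obtain ⟨h1, h2⟩ := h.vecState_mul_rieszCos_mul hL9 hL hm (h.testProd_mem_degreeStrip m a N)
      (h.rieszProd_mem_degreeStrip m N)
    obtain ⟨h3, -⟩ := h.vecState_mul_rieszCos_mul hL9 hL hm (h.testProd_mem_degreeStrip m a N)
      (h.altSum_mem_degreeStrip m N)
    set z : ℂ := Complex.I * ((-1) ^ N * a) with hz
    have h4 : testProd U V m a (N + 1) * altSum U V m (N + 1)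
        = testProd U V m a N * altSum U V m N
          + z • (testProd U V m a N * rieszCos U V m (N + 1) * altSum U V m N)
          + ((-1) ^ N : ℂ) • (testProd U V m a N * rieszCos U V m (N + 1) * rieszProd U V m N)
          + (z * (-1) ^ N) • (testProd U V m a N *
            (rieszCos U V m (N + 1) * rieszCos U V m (N + 1)) * rieszProd U V m N) := by
      have h5 : altSum U V m (N + 1) = altSum U V m N
          + ((-1) ^ N : ℂ) • (rieszCos U V m (N + 1) * rieszProd U V m N) :=
        Finset.sum_range_succ _ _
      rw [testProd, h5, ← hz]
      simp only [mul_add, add_mul, mul_one, mul_smul_comm, smul_mul_assoc, mul_assoc]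
      module
    rw [h4, ← vecStateₗ_apply, map_add, map_add, map_add, map_smul, map_smul, map_smul]
    simp only [vecStateₗ_apply, h1, h2, h3, smul_eq_mul]
    rw [Finset.sum_range_succ, ← ih, ← h.vecState_testProd_mul_rieszProd hL9 hL hm, hz]
    have h6 : ((-1 : ℂ) ^ N) * (-1) ^ N = 1 := by rw [← mul_pow]; simp
    linear_combination (Complex.I * a * 2⁻¹
      * vecState e (testProd U V m a N * rieszProd U V m N)) * h6

theorem le_im_vecState_testProd_mul_altSum (h : IsTraceVector U V ω e) (hL9 : 9 ≤ L)
    (hL : ∀ j, L * m j ≤ m (j + 1)) (hm : ∀ j, 1 ≤ m j) {a : ℝ} (ha : 0 ≤ a) (N : ℕ) :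
    a / 2 * N ≤ (vecState e (testProd U V m a N * altSum U V m N)).im := by
  have hq : ∀ n, ∃ r : ℝ, 1 ≤ r ∧ ∏ j ∈ Finset.range n, (1 + Complex.I * ((-1) ^ j * (a : ℂ)) / 2)
      = r * (if Even n then 1 else 1 + Complex.I * a / 2) := by
    intro n
    induction n with
    | zero => exact ⟨1, le_rfl, by simp⟩
    | succ n ih =>
      obtain ⟨r, hr, h1⟩ := ih
      rw [Finset.prod_range_succ, h1]
      by_cases hn : Even n
      · exact ⟨r, hr, by simp [hn, Nat.even_add_one]⟩
      · refine ⟨r * (1 + a ^ 2 / 4), by nlinarith [sq_nonneg a], ?_⟩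
        have hn' : Odd n := Nat.not_even_iff_odd.1 hn
        simp only [hn, if_false, Nat.even_add_one, not_false_eq_true, if_true, hn'.neg_one_pow]
        push_cast
        have hI : Complex.I * Complex.I = -1 := Complex.I_mul_I
        linear_combination (-(r : ℂ) * a ^ 2 / 4) * hI
  rw [h.vecState_testProd_mul_altSum hL9 hL hm, Complex.im_sum]
  have : a / 2 * N = ∑ _n ∈ Finset.range N, a / 2 := by simp [mul_comm]
  rw [this]
  refine Finset.sum_le_sum fun n _ => ?_
  obtain ⟨r, hr, h1⟩ := hq n
  rw [h1]
  have h2 : (Complex.I * a / 2 * (r * (if Even n then 1 else 1 + Complex.I * a / 2))).im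
      = a / 2 * r := by
    split_ifs <;> simp
  rw [h2]
  nlinarith

end IsTraceVector

end testOperator

section asymptoticCommutation

open Filter Topology

variable {A : Type*} [NormedRing A]

theorem tendsto_mul_zero_of_bounded {x y : ℕ → A} (hx : ∃ C : ℝ, ∀ n, ‖x n‖ ≤ C)
    (hy : Tendsto y atTop (𝓝 0)) : Tendsto (x * y) atTop (𝓝 0) := by
  obtain ⟨C, hC⟩ := hx
  exact isBoundedUnder_le_mul_tendsto_zero (isBoundedUnder_of ⟨C, hC⟩) hy

theorem tendsto_mul_zero_of_bounded_right {x y : ℕ → A} (hx : Tendsto x atTop (𝓝 0))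
    (hy : ∃ C : ℝ, ∀ n, ‖y n‖ ≤ C) : Tendsto (x * y) atTop (𝓝 0) := by
  obtain ⟨C, hC⟩ := hy
  exact hx.zero_mul_isBoundedUnder_le (isBoundedUnder_of ⟨C, hC⟩)

variable [NormedAlgebra ℂ A]

theorem exists_norm_le_of_mem_adjoin {D : Set (ℕ → A)} (hb : ∀ x ∈ D, ∃ C : ℝ, ∀ n, ‖x n‖ ≤ C)
    {X : ℕ → A} (hX : X ∈ Algebra.adjoin ℂ D) : ∃ C : ℝ, ∀ n, ‖X n‖ ≤ C := by
  induction hX using Algebra.adjoin_induction with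
  | mem x hx => exact hb x hx
  | algebraMap r => exact ⟨‖algebraMap ℂ A r‖, fun n => le_rfl⟩
  | add x y _ _ hx hy =>
    obtain ⟨C, hC⟩ := hx
    obtain ⟨C', hC'⟩ := hy
    exact ⟨C + C', fun n => (norm_add_le _ _).trans (add_le_add (hC n) (hC' n))⟩
  | mul x y _ _ hx hy =>
    obtain ⟨C, hC⟩ := hx
    obtain ⟨C', hC'⟩ := hy
    exact ⟨C * C', fun n => (norm_mul_le _ _).trans (mul_le_mul (hC n) (hC' n) (norm_nonneg _)
      ((norm_nonneg _).trans (hC n)))⟩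

theorem tendsto_commutator_of_mem_adjoin_right {D : Set (ℕ → A)}
    (hb : ∀ x ∈ D, ∃ C : ℝ, ∀ n, ‖x n‖ ≤ C) {x : ℕ → A}
    (hc : ∀ y ∈ D, Tendsto (x * y - y * x) atTop (𝓝 0)) {Y : ℕ → A}
    (hY : Y ∈ Algebra.adjoin ℂ D) : Tendsto (x * Y - Y * x) atTop (𝓝 0) := by
  induction hY using Algebra.adjoin_induction with
  | mem y hy => exact hc y hy
  | algebraMap r =>
    rw [Algebra.commutes r x, sub_self]
    exact tendsto_const_nhds
  | add y z _ _ hy hz =>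
    have : x * (y + z) - (y + z) * x = (x * y - y * x) + (x * z - z * x) := by noncomm_ring
    rw [this]
    have h := hy.add hz
    rw [add_zero] at h
    exact h
  | mul y z hy' hz' hy hz =>
    have : x * (y * z) - y * z * x = (x * y - y * x) * z + y * (x * z - z * x) := by noncomm_ring
    rw [this]
    have h := (tendsto_mul_zero_of_bounded_right hy (exists_norm_le_of_mem_adjoin hb hz')).add
      (tendsto_mul_zero_of_bounded (exists_norm_le_of_mem_adjoin hb hy') hz)
    rw [add_zero] at h
    exact h

/-- Bounded sequences generated by asymptotically commuting ones commute asymptotically. -/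
theorem tendsto_commutator_of_mem_adjoin {D : Set (ℕ → A)}
    (hb : ∀ x ∈ D, ∃ C : ℝ, ∀ n, ‖x n‖ ≤ C)
    (hc : ∀ x ∈ D, ∀ y ∈ D, Tendsto (x * y - y * x) atTop (𝓝 0)) {X Y : ℕ → A}
    (hX : X ∈ Algebra.adjoin ℂ D) (hY : Y ∈ Algebra.adjoin ℂ D) :
    Tendsto (X * Y - Y * X) atTop (𝓝 0) := by
  refine tendsto_commutator_of_mem_adjoin_right hb (fun y hy => ?_) hY
  have := (tendsto_commutator_of_mem_adjoin_right hb (hc y hy) hX).neg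
  rw [neg_zero] at this
  refine this.congr fun n => ?_
  simp

end asymptoticCommutation

section operatorInequalities

variable {H : Type*} [NormedAddCommGroup H] [InnerProductSpace ℂ H] [CompleteSpace H]

theorem IsSelfAdjoint.le_smul_one_of_norm_le {X : H →L[ℂ] H} (hX : IsSelfAdjoint X) {r : ℝ}
    (h : ‖X‖ ≤ r) : X ≤ r • (1 : H →L[ℂ] H) := by
  have h1 := hX.le_algebraMap_norm_self
  rw [Algebra.algebraMap_eq_smul_one] at h1
  exact h1.trans (smul_le_smul_of_nonneg_right h zero_le_one)

theorem opAbs_nonneg (T : H →L[ℂ] H) : 0 ≤ opAbs T := CFC.sqrt_nonneg _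

theorem opAbs_mul_self (T : H →L[ℂ] H) : opAbs T * opAbs T = star T * T :=
  CFC.sqrt_mul_sqrt_self _ (star_mul_self_nonneg T)

theorem opAbs_le_of_star_mul_self_le {T S : H →L[ℂ] H} (hS : 0 ≤ S) (h : star T * T ≤ S * S) :
    opAbs T ≤ S := by
  rw [← CFC.sqrt_mul_self S hS]
  exact CFC.sqrt_le_sqrt _ _ h

theorem IsSelfAdjoint.le_opAbs {X : H →L[ℂ] H} (hX : IsSelfAdjoint X) : X ≤ opAbs X := by
  have h : opAbs X - X = 2 • X⁻ := CFC.abs_sub_self X hX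
  rw [← sub_nonneg, h]
  exact nsmul_nonneg (CFC.negPart_nonneg X) 2

/-- If `T` is close to `S - 1` with `S` positive, its `L¹` norm is at most `τ(S) + 2`. -/
theorem l1Norm_le_of_close {e : H} (he : ‖e‖ = 1) {S T : H →L[ℂ] H} (hS : 0 ≤ S)
    (h : ‖star T * T - (S - 1) * (S - 1)‖ ≤ 3) : l1Norm e T ≤ (vecState e S).re + 2 := by
  have hSa : IsSelfAdjoint S := IsSelfAdjoint.of_nonneg hS
  have h1 : star T * T - (S - 1) * (S - 1) ≤ (3 : ℝ) • 1 := by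
    refine IsSelfAdjoint.le_smul_one_of_norm_le ?_ h
    have h2 : IsSelfAdjoint (S - 1) := hSa.sub (IsSelfAdjoint.one _)
    refine (IsSelfAdjoint.star_mul_self T).sub ?_
    rw [IsSelfAdjoint, star_mul, h2.star_eq]
  have h3 : opAbs T ≤ S + (2 : ℝ) • 1 := by
    have h2 : (0 : H →L[ℂ] H) ≤ (2 : ℝ) • 1 := smul_nonneg (by norm_num) zero_le_one
    refine opAbs_le_of_star_mul_self_le (add_nonneg hS h2) ?_
    have h4 : (S + (2 : ℝ) • (1 : H →L[ℂ] H)) * (S + (2 : ℝ) • 1) - star T * T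
        = ((3 : ℝ) • 1 - (star T * T - (S - 1) * (S - 1))) + (6 : ℝ) • S := by
      simp only [mul_add, add_mul, mul_sub, sub_mul, mul_one, one_mul, mul_smul_comm,
        smul_mul_assoc]
      module
    rw [← sub_nonneg, h4]
    exact add_nonneg (sub_nonneg.2 h1) (smul_nonneg (by norm_num) hS)
  have h5 := re_vecState_mono e h3
  have h6 : vecState e (S + (2 : ℝ) • (1 : H →L[ℂ] H)) = vecState e S + 2 := by
    have h7 : vecState e (1 : H →L[ℂ] H) = 1 := vecState_one he
    simp only [vecState] at h7 ⊢
    rw [add_apply, inner_add_right, smul_apply, inner_smul_right_eq_smul, h7]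
    simp
  rw [h6] at h5
  simpa [l1Norm] using h5

/-- Duality between the `L¹` norm and bounded operators, for nearly normal products. -/
theorem re_vecState_le_l1Norm {e : H} (he : ‖e‖ = 1) {φ T T₀ : H →L[ℂ] H} (hφ : ‖φ‖ ^ 2 ≤ 4)
    (hT : ‖star T₀ * T₀ - star T * T‖ ≤ 1 / 2)
    (hX : ‖φ * T₀ * star (φ * T₀) - star (φ * T₀) * (φ * T₀)‖ ≤ 2) :
    (vecState e (φ * T₀)).re ≤ 2 * l1Norm e T + 2 := by
  set X := φ * T₀ with hXdef
  set Y := (2⁻¹ : ℝ) • (X + star X) with hY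
  have hYa : IsSelfAdjoint Y := (IsSelfAdjoint.all (2⁻¹ : ℝ)).smul (IsSelfAdjoint.add_star_self X)
  have h1 : Y * Y ≤ star X * X + (1 : ℝ) • 1 := by
    have h2 : (0 : H →L[ℂ] H) ≤ star (X - star X) * (X - star X) := star_mul_self_nonneg _
    have h3 : X * star X - star X * X ≤ (2 : ℝ) • (1 : H →L[ℂ] H) :=
      ((IsSelfAdjoint.mul_star_self X).sub (IsSelfAdjoint.star_mul_self X)).le_smul_one_of_norm_le
        hX
    have h4 : star X * X + (1 : ℝ) • 1 - Y * Y = (2⁻¹ : ℝ) • ((2 : ℝ) • (1 : H →L[ℂ] H)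
        - (X * star X - star X * X)) + (4⁻¹ : ℝ) • (star (X - star X) * (X - star X)) := by
      rw [hY, smul_mul_smul_comm, star_sub, star_star]
      simp only [mul_add, add_mul, mul_sub, sub_mul]
      module
    rw [← sub_nonneg, h4]
    exact add_nonneg (smul_nonneg (by norm_num) (sub_nonneg.2 h3))
      (smul_nonneg (by norm_num) h2)
  have h5 : star X * X ≤ (4 : ℝ) • (star T₀ * T₀) := by
    have h6 : star φ * φ ≤ (4 : ℝ) • 1 := by
      refine (IsSelfAdjoint.star_mul_self φ).le_smul_one_of_norm_le ?_
      rw [CStarRing.norm_star_mul_self, ← pow_two]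
      exact hφ
    have h7 := star_left_conjugate_le_conjugate h6 T₀
    rw [hXdef, star_mul]
    simpa [mul_assoc] using h7
  have h8 : star T₀ * T₀ ≤ star T * T + (1 / 2 : ℝ) • 1 := by
    rw [add_comm, ← sub_le_iff_le_add]
    exact ((IsSelfAdjoint.star_mul_self T₀).sub
      (IsSelfAdjoint.star_mul_self T)).le_smul_one_of_norm_le hT
  have h9 : opAbs Y ≤ (2 : ℝ) • opAbs T + (2 : ℝ) • 1 := by
    have h10 : (0 : H →L[ℂ] H) ≤ (2 : ℝ) • 1 := smul_nonneg (by norm_num) zero_le_one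
    refine opAbs_le_of_star_mul_self_le
      (add_nonneg (smul_nonneg (by norm_num) (opAbs_nonneg T)) h10) ?_
    rw [hYa.star_eq]
    have h11 : ((2 : ℝ) • opAbs T + (2 : ℝ) • 1) * ((2 : ℝ) • opAbs T + (2 : ℝ) • 1) - Y * Y
        = (star X * X + (1 : ℝ) • 1 - Y * Y) + ((4 : ℝ) • (star T₀ * T₀) - star X * X)
          + (4 : ℝ) • (star T * T + (1 / 2 : ℝ) • 1 - star T₀ * T₀) + (8 : ℝ) • opAbs T
          + (1 : ℝ) • (1 : H →L[ℂ] H) := by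
      rw [← opAbs_mul_self T]
      simp only [mul_add, add_mul, mul_one, one_mul, mul_smul_comm, smul_mul_assoc]
      module
    rw [← sub_nonneg, h11]
    refine add_nonneg (add_nonneg (add_nonneg (add_nonneg (sub_nonneg.2 h1) (sub_nonneg.2 h5)) ?_)
      ?_) (smul_nonneg (by norm_num) zero_le_one)
    · exact smul_nonneg (by norm_num) (sub_nonneg.2 h8)
    · exact smul_nonneg (by norm_num) (opAbs_nonneg T)
  have h12 := re_vecState_mono e (hYa.le_opAbs.trans h9)
  have h13 : (vecState e Y).re = (vecState e X).re := by
    have h14 : vecState e (star X) = star (vecState e X) := by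
      rw [vecState, vecState, ContinuousLinearMap.star_eq_adjoint,
        ContinuousLinearMap.adjoint_inner_right, Complex.star_def, inner_conj_symm]
    have h15 : vecState e Y = (2⁻¹ : ℝ) • (vecState e X + vecState e (star X)) := by
      simp only [vecState, hY]
      rw [smul_apply, inner_smul_right_eq_smul, add_apply, inner_add_right]
    rw [h15, h14]
    simp
    ring
  have h16 : (vecState e ((2 : ℝ) • opAbs T + (2 : ℝ) • (1 : H →L[ℂ] H))).re
      = 2 * l1Norm e T + 2 := by
    have h7 : vecState e (1 : H →L[ℂ] H) = 1 := vecState_one he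
    simp only [vecState, l1Norm] at h7 ⊢
    rw [add_apply, inner_add_right, smul_apply, smul_apply, inner_smul_right_eq_smul,
      inner_smul_right_eq_smul, h7]
    simp
  rw [h13, h16] at h12
  exact h12

end operatorInequalities

section recurrence

theorem exists_norm_pow_sub_one_lt {ω : ℂ} (hω : ‖ω‖ = 1) {ε : ℝ} (hε : 0 < ε) (R : ℕ) :
    ∃ n, R ≤ n ∧ ‖ω ^ n - 1‖ < ε := by
  obtain ⟨a, -, φ, hφ, ha⟩ := tendsto_subseq_of_bounded (x := fun n : ℕ => ω ^ n)
    (s := Metric.closedBall 0 1) Metric.isBounded_closedBall (fun n => by simp [hω])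
  obtain ⟨p, hp⟩ := Metric.cauchySeq_iff'.1 ha.cauchySeq ε hε
  have hle : φ p + R ≤ φ (p + R) := by
    simpa [add_comm] using hφ.add_le_nat R p
  refine ⟨φ (p + R) - φ p, by omega, ?_⟩
  have h1 := hp (p + R) (by omega)
  have h2 : ω ^ φ (p + R) - ω ^ φ p = ω ^ φ p * (ω ^ (φ (p + R) - φ p) - 1) := by
    rw [mul_sub, ← pow_add, mul_one]
    congr 2
    omega
  simpa [dist_eq_norm, h2, hω] using h1

theorem norm_pow_sub_one_le {z : ℂ} (hz : ‖z‖ = 1) (k : ℕ) : ‖z ^ k - 1‖ ≤ k * ‖z - 1‖ := by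
  induction k with
  | zero => simp
  | succ k ih =>
    have h1 : z ^ (k + 1) - 1 = z * (z ^ k - 1) + (z - 1) := by ring
    rw [h1]
    refine (norm_add_le _ _).trans ?_
    rw [norm_mul, hz, one_mul]
    push_cast
    linarith

/-- Rapidly growing integers whose pairwise products are almost periods of `n ↦ ω ^ (2 n)`. -/
theorem exists_lacunary_almost_period {ω : ℂ} (hω : ‖ω‖ = 1) {ε : ℝ} (hε : 0 < ε) {L : ℕ}
    (hL : 1 ≤ L) : ∃ m : ℕ → ℕ, (∀ j, 1 ≤ m j) ∧ (∀ j, L * m j ≤ m (j + 1)) ∧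
      ∀ i j, i ≠ j → ‖ω ^ (2 * (m i * m j)) - 1‖ ≤ ε := by
  choose f hf1 hf2 using fun x : ℕ =>
    exists_norm_pow_sub_one_lt hω (show 0 < ε / (2 * (x + 1)) by positivity) (L * x + 1)
  set m : ℕ → ℕ := fun j => Nat.rec 1 (fun _ x => f x) j with hmdef
  have hm : ∀ j, m (j + 1) = f (m j) := fun j => rfl
  have h1 : ∀ j, L * m j + 1 ≤ m (j + 1) := fun j => hm j ▸ hf1 (m j)
  have hmono : Monotone m := monotone_nat_of_le_succ fun j => by
    nlinarith [h1 j, Nat.le_mul_of_pos_left (m j) hL]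
  have key : ∀ i j, i < j → ‖ω ^ (2 * (m i * m j)) - 1‖ ≤ ε := by
    intro i j hij
    obtain ⟨j, rfl⟩ := Nat.exists_eq_add_of_lt hij
    have h2 : (m i : ℝ) ≤ m (i + j) := by exact_mod_cast hmono (by omega)
    have h3 := norm_pow_sub_one_le (show ‖ω ^ m (i + j + 1)‖ = 1 by simp [hω]) (2 * m i)
    rw [← pow_mul, hm] at h3
    have h4 := (hf2 (m (i + j))).le
    rw [hm, show 2 * (m i * f (m (i + j))) = f (m (i + j)) * (2 * m i) by ring]
    refine h3.trans ((mul_le_mul_of_nonneg_left h4 (by positivity)).trans ?_)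
    push_cast
    rw [← mul_div_assoc, div_le_iff₀ (by positivity)]
    nlinarith
  refine ⟨m, fun j => ?_, fun j => by linarith [h1 j], fun i j hij => ?_⟩
  · cases j with
    | zero => exact le_rfl
    | succ j => linarith [h1 j, Nat.zero_le (L * m j)]
  · rcases lt_or_gt_of_ne hij with h | h
    · exact key i j h
    · rw [mul_comm (m i)]
      exact key j i h

end recurrence

section commutators

variable {H : Type*} [NormedAddCommGroup H] [InnerProductSpace ℂ H] [CompleteSpace H]
  {U V : unitary (H →L[ℂ] H)} {ω : ℂ} {e : H}

theorem IsTraceVector.norm_commutator_qMono_le (h : IsTraceVector U V ω e) (k l : ℤ × ℤ) :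
    ‖qMono U V k * qMono U V l - qMono U V l * qMono U V k‖
      ≤ ‖ω ^ (l.2 * k.1 - k.2 * l.1) - 1‖ := by
  have h1 : qMono U V k * qMono U V l - qMono U V l * qMono U V k
      = (ω ^ (-(l.2 * k.1)) * (ω ^ (l.2 * k.1 - k.2 * l.1) - 1)) • qMono U V (k + l) := by
    rw [h.qMono_mul, h.qMono_mul, add_comm l k, ← sub_smul, mul_sub, mul_one,
      ← zpow_add₀ h.phase_ne_zero]
    congr 3
    ring
  rw [h1, norm_smul, norm_mul, h.norm_phase_zpow, one_mul]
  exact mul_le_of_le_one_right (norm_nonneg _) (norm_qMono_le U V _)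

theorem norm_zpow_neg_sub_one {ω : ℂ} (hω : ‖ω‖ = 1) (n : ℤ) : ‖ω ^ (-n) - 1‖ = ‖ω ^ n - 1‖ := by
  have h0 : ω ≠ 0 := fun h => by simp [h] at hω
  have h1 : ω ^ (-n) - 1 = -(ω ^ (-n) * (ω ^ n - 1)) := by
    rw [mul_sub, ← zpow_add₀ h0]
    simp
  rw [h1, norm_neg, norm_mul, norm_zpow, hω, one_zpow, one_mul]

theorem IsTraceVector.norm_commutator_smul_baseVec_le (h : IsTraceVector U V ω e) {m : ℕ → ℕ}
    {ε : ℝ} (hε : 0 ≤ ε) (hm : ∀ i j, i ≠ j → ‖ω ^ (2 * (m i * m j)) - 1‖ ≤ ε) (i j : ℕ)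
    {s t : ℤ} (hs : s = 1 ∨ s = -1) (ht : t = 1 ∨ t = -1) :
    ‖qMono U V (s • baseVec m i) * qMono U V (t • baseVec m j)
      - qMono U V (t • baseVec m j) * qMono U V (s • baseVec m i)‖ ≤ ε := by
  refine (h.norm_commutator_qMono_le _ _).trans ?_
  by_cases hij : i = j
  · subst hij
    have : (t • baseVec m i).2 * (s • baseVec m i).1 - (s • baseVec m i).2 * (t • baseVec m i).1
        = 0 := by
      simp only [Prod.smul_fst, Prod.smul_snd, smul_eq_mul]
      ring
    rw [this]
    simpa using hε
  · have h1 : ∃ r : ℤ, (r = 0 ∨ r = 1 ∨ r = -1) ∧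
        (t • baseVec m j).2 * (s • baseVec m i).1 - (s • baseVec m i).2 * (t • baseVec m j).1
        = r * ((2 * (m i * m j) : ℕ) : ℤ) := by
      simp only [baseVec, Prod.smul_fst, Prod.smul_snd, smul_eq_mul]
      rcases hs with rfl | rfl <;> rcases ht with rfl | rfl <;>
      rcases neg_one_pow_eq_or ℤ (i - 1) with h1 | h1 <;>
      rcases neg_one_pow_eq_or ℤ (j - 1) with h2 | h2 <;> rw [h1, h2] <;> push_cast
      all_goals first
        | exact ⟨0, by simp, by ring1⟩
        | exact ⟨1, by simp, by ring1⟩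
        | exact ⟨-1, by simp, by ring1⟩
    obtain ⟨r, hr, h2⟩ := h1
    rw [h2]
    rcases hr with rfl | rfl | rfl
    · simpa using hε
    · rw [one_mul, zpow_natCast]
      exact hm i j hij
    · rw [neg_one_mul, norm_zpow_neg_sub_one h.norm_phase, zpow_natCast]
      exact hm i j hij

end commutators

section asymptoticFactorization

open Filter Topology

variable {H : Type*} [NormedAddCommGroup H] [InnerProductSpace ℂ H] [CompleteSpace H]
  {U V : unitary (H →L[ℂ] H)} {ω : ℂ} {e : H} {m : ℕ → ℕ → ℕ}

/-- The sequences of monomials `n ↦ U^{± m_{n,j}} V^{m_{n,j}}` and their adjoints. -/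
def monoSeqs (U V : unitary (H →L[ℂ] H)) (m : ℕ → ℕ → ℕ) : Set (ℕ → H →L[ℂ] H) :=
  {X | ∃ j, X = (fun n => qMono U V (baseVec (m n) j)) ∨
    X = star (fun n => qMono U V (baseVec (m n) j))}

/-- The algebra generated by `monoSeqs`. -/
noncomputable def monoSeqAlg (U V : unitary (H →L[ℂ] H)) (m : ℕ → ℕ → ℕ) :
    Subalgebra ℂ (ℕ → H →L[ℂ] H) := Algebra.adjoin ℂ (monoSeqs U V m)

theorem star_mem_monoSeqAlg {X : ℕ → H →L[ℂ] H} (hX : X ∈ monoSeqAlg U V m) :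
    star X ∈ monoSeqAlg U V m := by
  induction hX using Algebra.adjoin_induction with
  | mem x hx =>
    refine Algebra.subset_adjoin ?_
    obtain ⟨j, rfl | rfl⟩ := hx
    · exact ⟨j, Or.inr rfl⟩
    · exact ⟨j, Or.inl (star_star _)⟩
  | algebraMap r =>
    rw [← algebraMap_star_comm]
    exact Subalgebra.algebraMap_mem _ _
  | add x y _ _ hx hy => rw [star_add]; exact add_mem hx hy
  | mul x y _ _ hx hy => rw [star_mul]; exact mul_mem hy hx

theorem qMono_mem_monoSeqAlg (U V : unitary (H →L[ℂ] H)) (m : ℕ → ℕ → ℕ) (j : ℕ) :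
    (fun n => qMono U V (baseVec (m n) j)) ∈ monoSeqAlg U V m :=
  Algebra.subset_adjoin ⟨j, Or.inl rfl⟩

theorem rieszCos_mem_monoSeqAlg (U V : unitary (H →L[ℂ] H)) (m : ℕ → ℕ → ℕ) (j : ℕ) :
    (fun n => rieszCos U V (m n) j) ∈ monoSeqAlg U V m :=
  Subalgebra.smul_mem _ (add_mem (qMono_mem_monoSeqAlg U V m j)
    (star_mem_monoSeqAlg (qMono_mem_monoSeqAlg U V m j))) _

theorem rieszProd_mem_monoSeqAlg (U V : unitary (H →L[ℂ] H)) (m : ℕ → ℕ → ℕ) (N : ℕ) :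
    (fun n => rieszProd U V (m n) N) ∈ monoSeqAlg U V m := by
  induction N with
  | zero => exact one_mem _
  | succ N ih =>
    simp only [rieszProd_succ]
    exact add_mem ih (mul_mem (rieszCos_mem_monoSeqAlg U V m (N + 1)) ih)

theorem altSum_mem_monoSeqAlg (U V : unitary (H →L[ℂ] H)) (m : ℕ → ℕ → ℕ) (N : ℕ) :
    (fun n => altSum U V (m n) N) ∈ monoSeqAlg U V m := by
  induction N with
  | zero =>
    simp only [altSum, Finset.range_zero, Finset.sum_empty]
    exact zero_mem (monoSeqAlg U V m)
  | succ N ih =>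
    simp only [altSum, Finset.sum_range_succ] at ih ⊢
    exact add_mem ih (Subalgebra.smul_mem _ (mul_mem (rieszCos_mem_monoSeqAlg U V m (N + 1))
      (rieszProd_mem_monoSeqAlg U V m N)) _)

theorem testProd_mem_monoSeqAlg (U V : unitary (H →L[ℂ] H)) (m : ℕ → ℕ → ℕ) (a : ℝ) (N : ℕ) :
    (fun n => testProd U V (m n) a N) ∈ monoSeqAlg U V m := by
  induction N with
  | zero => exact one_mem _
  | succ N ih =>
    exact mul_mem ih (add_mem (one_mem _)
      (Subalgebra.smul_mem _ (rieszCos_mem_monoSeqAlg U V m (N + 1)) _))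

/-- The product of the operators `(1 + u_j) / √2`, whose squared moduli are the factors of the
Riesz product. -/
noncomputable def halfProd (U V : unitary (H →L[ℂ] H)) (m : ℕ → ℕ) : ℕ → H →L[ℂ] H
  | 0 => 1
  | N + 1 => (((√2 : ℝ) : ℂ)⁻¹ • (1 + qMono U V (baseVec m (N + 1)))) * halfProd U V m N

theorem halfProd_mem_monoSeqAlg (U V : unitary (H →L[ℂ] H)) (m : ℕ → ℕ → ℕ) (N : ℕ) :
    (fun n => halfProd U V (m n) N) ∈ monoSeqAlg U V m := by
  induction N with
  | zero => exact one_mem _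
  | succ N ih =>
    exact mul_mem (Subalgebra.smul_mem _ (add_mem (one_mem _)
      (qMono_mem_monoSeqAlg U V m (N + 1))) _) ih

theorem half_mul_star_half (U V : unitary (H →L[ℂ] H)) (m : ℕ → ℕ) (j : ℕ) :
    (((√2 : ℝ) : ℂ)⁻¹ • (1 + qMono U V (baseVec m j))) *
      star (((√2 : ℝ) : ℂ)⁻¹ • (1 + qMono U V (baseVec m j))) = 1 + rieszCos U V m j := by
  have h2 : (((√2 : ℝ) : ℂ)⁻¹) * ((√2 : ℝ) : ℂ)⁻¹ = 2⁻¹ := by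
    rw [← mul_inv, ← Complex.ofReal_mul, Real.mul_self_sqrt (by norm_num)]
    norm_num
  have h3 : star (((√2 : ℝ) : ℂ)⁻¹) = ((√2 : ℝ) : ℂ)⁻¹ := by
    rw [star_inv₀, Complex.star_def, Complex.conj_ofReal]
  rw [star_smul, h3, smul_mul_smul_comm, h2, star_add, star_one, mul_add, add_mul, add_mul,
    qMono_mul_star_self, rieszCos]
  simp only [one_mul, mul_one]
  module

/-- Along a sequence, the monomials of `monoSeqs` commute asymptotically. -/
theorem IsTraceVector.tendsto_commutator (h : IsTraceVector U V ω e) {ε : ℕ → ℝ}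
    (hε : Tendsto ε atTop (𝓝 0)) (hε0 : ∀ n, 0 ≤ ε n)
    (hm : ∀ n i j, i ≠ j → ‖ω ^ (2 * (m n i * m n j)) - 1‖ ≤ ε n) {X Y : ℕ → H →L[ℂ] H}
    (hX : X ∈ monoSeqAlg U V m) (hY : Y ∈ monoSeqAlg U V m) :
    Tendsto (X * Y - Y * X) atTop (𝓝 0) := by
  have hrep : ∀ X ∈ monoSeqs U V m, ∃ j, ∃ s : ℤ, (s = 1 ∨ s = -1) ∧ ∀ n, ∃ c : ℂ, ‖c‖ = 1 ∧
      X n = c • qMono U V (s • baseVec (m n) j) := by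
    rintro X ⟨j, rfl | rfl⟩
    · exact ⟨j, 1, Or.inl rfl, fun n => ⟨1, by simp, by simp⟩⟩
    · refine ⟨j, -1, Or.inr rfl, fun n =>
        ⟨_, h.norm_phase_zpow (-((baseVec (m n) j).1 * (baseVec (m n) j).2)), ?_⟩⟩
      rw [neg_one_smul]
      exact h.star_qMono _
  refine tendsto_commutator_of_mem_adjoin (fun X hX => ⟨1, fun n => ?_⟩)
    (fun X hX Y hY => ?_) hX hY
  · obtain ⟨j, s, -, hX⟩ := hrep X hX
    obtain ⟨c, hc, hX⟩ := hX n
    rw [hX, norm_smul, hc, one_mul]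
    exact norm_qMono_le U V _
  · obtain ⟨i, s, hs, hX⟩ := hrep X hX
    obtain ⟨j, t, ht, hY⟩ := hrep Y hY
    refine squeeze_zero_norm (fun n => ?_) hε
    obtain ⟨c, hc, hX⟩ := hX n
    obtain ⟨d, hd, hY⟩ := hY n
    rw [Pi.sub_apply, Pi.mul_apply, Pi.mul_apply, hX, hY, smul_mul_smul_comm, smul_mul_smul_comm,
      mul_comm d c, ← smul_sub, norm_smul, norm_mul, hc, hd, one_mul, one_mul]
    exact h.norm_commutator_smul_baseVec_le (hε0 n) (hm n) i j hs ht

theorem exists_norm_le_of_mem_monoSeqAlg {X : ℕ → H →L[ℂ] H}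
    (hX : X ∈ monoSeqAlg U V m) : ∃ C : ℝ, ∀ n, ‖X n‖ ≤ C := by
  refine exists_norm_le_of_mem_adjoin (fun X hX => ⟨1, fun n => ?_⟩) hX
  obtain ⟨j, rfl | rfl⟩ := hX
  · exact norm_qMono_le U V _
  · rw [Pi.star_apply, norm_star]
    exact norm_qMono_le U V _

/-- The Riesz product is asymptotically the positive operator `G G^*`. -/
theorem IsTraceVector.tendsto_rieszProd_sub (h : IsTraceVector U V ω e) {ε : ℕ → ℝ}
    (hε : Tendsto ε atTop (𝓝 0)) (hε0 : ∀ n, 0 ≤ ε n)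
    (hm : ∀ n i j, i ≠ j → ‖ω ^ (2 * (m n i * m n j)) - 1‖ ≤ ε n) (N : ℕ) :
    Tendsto (fun n => rieszProd U V (m n) N
      - halfProd U V (m n) N * star (halfProd U V (m n) N)) atTop (𝓝 0) := by
  induction N with
  | zero => simp [rieszProd, halfProd]
  | succ N ih =>
    set g : ℕ → H →L[ℂ] H :=
      fun n => ((√2 : ℝ) : ℂ)⁻¹ • (1 + qMono U V (baseVec (m n) (N + 1))) with hg
    set G : ℕ → H →L[ℂ] H := fun n => halfProd U V (m n) N with hG
    have hgm : g ∈ monoSeqAlg U V m := Subalgebra.smul_mem _ (add_mem (one_mem _)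
      (qMono_mem_monoSeqAlg U V m (N + 1))) _
    have hGm : G ∈ monoSeqAlg U V m := halfProd_mem_monoSeqAlg U V m N
    have h1 := tendsto_mul_zero_of_bounded
      (exists_norm_le_of_mem_monoSeqAlg (mul_mem hgm (star_mem_monoSeqAlg hgm))) ih
    have h2 := tendsto_mul_zero_of_bounded (exists_norm_le_of_mem_monoSeqAlg hgm)
      (h.tendsto_commutator hε hε0 hm (star_mem_monoSeqAlg hgm)
        (mul_mem hGm (star_mem_monoSeqAlg hGm)))
    have h3 := h1.add h2
    rw [add_zero] at h3
    refine h3.congr fun n => ?_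
    have h4 : rieszProd U V (m n) (N + 1) = g n * star (g n) * rieszProd U V (m n) N := by
      rw [half_mul_star_half, rieszProd_succ, add_mul, one_mul]
    have h5 : halfProd U V (m n) (N + 1) = g n * G n := rfl
    rw [h4, h5, star_mul]
    simp only [Pi.mul_apply, Pi.sub_apply, Pi.star_apply]
    simp only [hG]
    noncomm_ring

end asymptoticFactorization

section asymptoticNorms

open Filter Topology

variable {H : Type*} [NormedAddCommGroup H] [InnerProductSpace ℂ H] [CompleteSpace H]
  {U V : unitary (H →L[ℂ] H)} {ω : ℂ} {e : H}

theorem abs_sq_coord_ratio_sub_one_le {m : ℕ → ℕ} {L j : ℕ} (hL9 : 9 ≤ L)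
    (hL : ∀ j, L * m j ≤ m (j + 1)) (hm : ∀ j, 1 ≤ m j) {k : ℤ × ℤ} (hk : k ∈ Mset m (j + 1)) :
    |(k.1 : ℝ) * k.1 / (k.2 : ℝ) ^ 2 - 1| ≤ 12 / ((L : ℝ) - 1) := by
  have h1 := abs_coord_ratio_le hL9 hL hm (Nat.le_add_left 1 j) hk
  rw [Nat.add_sub_cancel] at h1
  have hL' : (9 : ℝ) ≤ L := by exact_mod_cast hL9
  have h2 : 4 / ((L : ℝ) - 1) ≤ 1 := by
    rw [div_le_one (by linarith)]
    linarith
  have hs : |(-1 : ℝ) ^ j| = 1 := by simp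
  have hss : ((-1 : ℝ) ^ j) * (-1) ^ j = 1 := by rw [← mul_pow]; simp
  set r : ℝ := (k.1 : ℝ) / k.2
  have h3 : (k.1 : ℝ) * k.1 / (k.2 : ℝ) ^ 2 - 1 = (r - (-1) ^ j) * (r + (-1) ^ j) := by
    rw [pow_two, mul_div_mul_comm]
    linear_combination hss
  have h4 : |r + (-1) ^ j| ≤ 3 := by
    have h5 := abs_add_le (r - (-1) ^ j) (2 * (-1) ^ j)
    rw [abs_mul, hs, show r - (-1) ^ j + 2 * (-1) ^ j = r + (-1) ^ j by ring] at h5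
    norm_num at h5
    linarith
  rw [h3, abs_mul, show (12 : ℝ) / (L - 1) = 4 / (L - 1) * 3 by ring]
  exact mul_le_mul h1 h4 (abs_nonneg _) ((abs_nonneg _).trans h1)

theorem sum_rieszCos_mul_rieszProd (U V : unitary (H →L[ℂ] H)) (m : ℕ → ℕ) (N : ℕ) :
    ∑ j ∈ Finset.range N, rieszCos U V m (j + 1) * rieszProd U V m j = rieszProd U V m N - 1 := by
  induction N with
  | zero => simp [rieszProd]
  | succ N ih =>
    rw [Finset.sum_range_succ, ih, rieszProd_succ]
    abel

theorem IsTraceVector.vecState_rieszProd (h : IsTraceVector U V ω e) {m : ℕ → ℕ} {L : ℕ}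
    (hL9 : 9 ≤ L) (hL : ∀ j, L * m j ≤ m (j + 1)) (hm : ∀ j, 1 ≤ m j) (N : ℕ) :
    vecState e (rieszProd U V m N) = 1 := by
  induction N with
  | zero => exact vecState_one h.norm_vec
  | succ N ih =>
    have h1 := (h.vecState_mul_rieszCos_mul hL9 hL hm
      (one_mem_monoSpan (zero_mem_degreeStrip m N)) (h.rieszProd_mem_degreeStrip m N)).1
    rw [one_mul] at h1
    rw [rieszProd_succ, ← vecStateₗ_apply, map_add, vecStateₗ_apply, vecStateₗ_apply, h1, ih,
      add_zero]

theorem tendsto_star_mul_self_sub {X Y : ℕ → H →L[ℂ] H} (hXY : Tendsto (X - Y) atTop (𝓝 0))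
    (hY : ∃ C : ℝ, ∀ n, ‖Y n‖ ≤ C) : Tendsto (star X * X - star Y * Y) atTop (𝓝 0) := by
  have h1 : Tendsto (star (X - Y)) atTop (𝓝 0) := by
    have := hXY.star
    rwa [star_zero] at this
  have hsY : ∃ C : ℝ, ∀ n, ‖star Y n‖ ≤ C := by
    obtain ⟨C, hC⟩ := hY
    exact ⟨C, fun n => by rw [Pi.star_apply, norm_star]; exact hC n⟩
  have h2 := h1.mul hXY
  rw [mul_zero] at h2
  have h3 := (h2.add (tendsto_mul_zero_of_bounded hsY hXY)).add
    (tendsto_mul_zero_of_bounded_right h1 hY)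
  rw [add_zero, add_zero] at h3
  refine h3.congr fun n => ?_
  simp only [Pi.mul_apply, Pi.sub_apply, Pi.star_apply, star_sub]
  noncomm_ring

variable {m : ℕ → ℕ → ℕ} {L : ℕ → ℕ}

namespace IsTraceVector

theorem tendsto_derivW_sub (h : IsTraceVector U V ω e) (hL9 : ∀ n, 9 ≤ L n)
    (hLtop : Tendsto L atTop atTop) (hL : ∀ n j, L n * m n j ≤ m n (j + 1))
    (hm : ∀ n j, 1 ≤ m n j) (N a b : ℕ) (s : ℕ → ℝ)
    (hs : ∀ n j, ∀ k ∈ Mset (m n) (j + 1),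
      |(kCoord a k : ℝ) * kCoord b k / (k.2 : ℝ) ^ 2 - s j| ≤ 12 / ((L n : ℝ) - 1)) :
    Tendsto (fun n => derivW e U V (m n) N a b
      - ∑ j ∈ Finset.range N, (s j : ℂ) • (rieszCos U V (m n) (j + 1) * rieszProd U V (m n) j))
      atTop (𝓝 0) := by
  refine squeeze_zero_norm (fun n => h.norm_derivW_sub_le (hL9 n) (hL n) (hm n) N a b s (hs n)) ?_
  have h1 : Tendsto (fun n => 12 / ((L n : ℝ) - 1)) atTop (𝓝 0) := by
    refine Tendsto.div_atTop tendsto_const_nhds ?_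
    exact tendsto_atTop_add_const_right _ (-1) (tendsto_natCast_atTop_atTop.comp hLtop)
  have h2 := ((h1.mul_const (2 * 2 ^ N : ℝ)).const_mul (3 ^ N : ℝ)).const_mul (N : ℝ)
  simpa using h2

/-- The pure second derivatives of the modified Riesz products have bounded `L¹` norm. -/
theorem eventually_l1Norm_le (h : IsTraceVector U V ω e) (hL9 : ∀ n, 9 ≤ L n)
    (hLtop : Tendsto L atTop atTop) (hL : ∀ n j, L n * m n j ≤ m n (j + 1))
    (hm : ∀ n j, 1 ≤ m n j) {ε : ℕ → ℝ} (hε : Tendsto ε atTop (𝓝 0)) (hε0 : ∀ n, 0 ≤ ε n)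
    (hmε : ∀ n i j, i ≠ j → ‖ω ^ (2 * (m n i * m n j)) - 1‖ ≤ ε n) (N : ℕ) {a : ℕ}
    (ha : a = 1 ∨ a = 2) :
    ∀ᶠ n in atTop, l1Norm e (derivW e U V (m n) N a a) ≤ 4 := by
  set S : ℕ → H →L[ℂ] H := fun n => halfProd U V (m n) N * star (halfProd U V (m n) N) with hS
  have hSm : S ∈ monoSeqAlg U V m :=
    mul_mem (halfProd_mem_monoSeqAlg U V m N)
      (star_mem_monoSeqAlg (halfProd_mem_monoSeqAlg U V m N))
  have hS1 : (S - 1 : ℕ → H →L[ℂ] H) ∈ monoSeqAlg U V m := sub_mem hSm (one_mem _)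
  have hPS := h.tendsto_rieszProd_sub hε hε0 hmε N
  have hT := h.tendsto_derivW_sub hL9 hLtop hL hm N a a (fun _ => 1) fun n j k hk => by
    rcases ha with rfl | rfl
    · exact abs_sq_coord_ratio_sub_one_le (hL9 n) (hL n) (hm n) hk
    · have h0 : (0 : ℤ) < k.2 :=
        (partialSum_nonneg _ _).trans_lt (partialSum_lt_snd (hL9 n) (hL n) (hm n) hk)
      have h1 : (k.2 : ℝ) ≠ 0 := by exact_mod_cast h0.ne'
      have h2 : (9 : ℝ) ≤ L n := by exact_mod_cast hL9 n
      have h3 : (kCoord 2 k : ℝ) * kCoord 2 k / (k.2 : ℝ) ^ 2 - 1 = 0 := by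
        simp only [kCoord, OfNat.ofNat_ne_one, if_false]
        field_simp
        simp
      rw [h3, abs_zero]
      exact div_nonneg (by norm_num) (by linarith)
  simp only [Complex.ofReal_one, one_smul, sum_rieszCos_mul_rieszProd] at hT
  have hTS : Tendsto ((fun n => derivW e U V (m n) N a a) - (S - 1)) atTop (𝓝 0) := by
    have h1 := hT.add hPS
    rw [add_zero] at h1
    refine h1.congr fun n => ?_
    simp only [Pi.sub_apply, Pi.one_apply, hS]
    abel
  have h1 := (tendsto_star_mul_self_sub hTS (exists_norm_le_of_mem_monoSeqAlg hS1)).norm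
  rw [norm_zero] at h1
  have h2 := hPS.norm
  rw [norm_zero] at h2
  filter_upwards [h1.eventually_le_const (show (0 : ℝ) < 3 by norm_num),
    h2.eventually_le_const (show (0 : ℝ) < 1 by norm_num)] with n hn1 hn2
  have hSn : 0 ≤ S n := mul_star_self_nonneg _
  have hSa : IsSelfAdjoint (S n - 1) := (IsSelfAdjoint.of_nonneg hSn).sub (IsSelfAdjoint.one _)
  have h3 : l1Norm e (derivW e U V (m n) N a a) ≤ (vecState e (S n)).re + 2 := by
    refine l1Norm_le_of_close h.norm_vec hSn ?_
    simpa only [Pi.sub_apply, Pi.mul_apply, Pi.star_apply, Pi.one_apply, hSa.star_eq] using hn1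
  have h4 : 1 - vecState e (S n) = vecState e (rieszProd U V (m n) N - S n) := by
    rw [← vecStateₗ_apply, ← vecStateₗ_apply, map_sub, vecStateₗ_apply, vecStateₗ_apply,
      h.vecState_rieszProd (hL9 n) (hL n) (hm n)]
  have h5 := (Complex.abs_re_le_norm (1 - vecState e (S n))).trans
    (h4 ▸ (norm_vecState_le h.norm_vec _).trans hn2)
  rw [Complex.sub_re, Complex.one_re, abs_le] at h5
  linarith [h5.1]

/-- The mixed second derivative of the modified Riesz products has large `L¹` norm. -/
theorem eventually_le_l1Norm (h : IsTraceVector U V ω e) (hL9 : ∀ n, 9 ≤ L n)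
    (hLtop : Tendsto L atTop atTop) (hL : ∀ n j, L n * m n j ≤ m n (j + 1))
    (hm : ∀ n j, 1 ≤ m n j) {ε : ℕ → ℝ} (hε : Tendsto ε atTop (𝓝 0)) (hε0 : ∀ n, 0 ≤ ε n)
    (hmε : ∀ n i j, i ≠ j → ‖ω ^ (2 * (m n i * m n j)) - 1‖ ≤ ε n) (N : ℕ) {a : ℝ} (ha : 0 ≤ a)
    (haN : (1 + a ^ 2) ^ N ≤ 4) :
    ∀ᶠ n in atTop, a / 2 * N ≤ 2 * l1Norm e (derivW e U V (m n) N 1 2) + 2 := by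
  have : Nontrivial H := nontrivial_of_ne e 0 (norm_ne_zero_iff.1 (by simp [h.norm_vec]))
  set T₀ : ℕ → H →L[ℂ] H := fun n => altSum U V (m n) N with hT₀
  set φ : ℕ → H →L[ℂ] H := fun n => (-Complex.I) • testProd U V (m n) a N with hφ
  have hT₀m : T₀ ∈ monoSeqAlg U V m := altSum_mem_monoSeqAlg U V m N
  have hφm : φ ∈ monoSeqAlg U V m := Subalgebra.smul_mem _ (testProd_mem_monoSeqAlg U V m a N) _
  have hT := h.tendsto_derivW_sub hL9 hLtop hL hm N 1 2 (fun j => (-1) ^ j) fun n j k hk => by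
    have h0 : (0 : ℤ) < k.2 :=
      (partialSum_nonneg _ _).trans_lt (partialSum_lt_snd (hL9 n) (hL n) (hm n) hk)
    have h1 : (k.2 : ℝ) ≠ 0 := by exact_mod_cast h0.ne'
    have h2 : (9 : ℝ) ≤ L n := by exact_mod_cast hL9 n
    have h3 : (kCoord 1 k : ℝ) * kCoord 2 k / (k.2 : ℝ) ^ 2 = k.1 / k.2 := by
      simp only [kCoord, OfNat.ofNat_ne_one, if_false, if_true]
      field_simp
    rw [h3]
    refine (abs_coord_ratio_le (hL9 n) (hL n) (hm n) (Nat.le_add_left 1 j) hk).trans ?_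
    exact div_le_div_of_nonneg_right (by norm_num) (by linarith)
  have hTT : Tendsto ((fun n => derivW e U V (m n) N 1 2) - T₀) atTop (𝓝 0) := by
    refine hT.congr fun n => ?_
    simp [hT₀, altSum]
  have h1 := (tendsto_star_mul_self_sub hTT (exists_norm_le_of_mem_monoSeqAlg hT₀m)).norm
  rw [norm_zero] at h1
  have hX := mul_mem hφm hT₀m
  have h2 := (h.tendsto_commutator hε hε0 hmε hX (star_mem_monoSeqAlg hX)).norm
  rw [norm_zero] at h2
  filter_upwards [h1.eventually_le_const (show (0 : ℝ) < 1 / 2 by norm_num),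
    h2.eventually_le_const (show (0 : ℝ) < 2 by norm_num)] with n hn1 hn2
  have h3 : ‖φ n‖ ^ 2 ≤ 4 := by
    rw [hφ, norm_smul, norm_neg, Complex.norm_I, one_mul]
    exact (norm_testProd_sq_le U V (m n) a N).trans haN
  have h4 : (vecState e (φ n * T₀ n)).re
      = (vecState e (testProd U V (m n) a N * altSum U V (m n) N)).im := by
    rw [hφ, smul_mul_assoc, ← vecStateₗ_apply, map_smul, vecStateₗ_apply]
    simp [hT₀]
  have h5 := h.le_im_vecState_testProd_mul_altSum (hL9 n) (hL n) (hm n) ha N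
  rw [← h4] at h5
  refine h5.trans (re_vecState_le_l1Norm h.norm_vec h3 ?_ hn2)
  rw [norm_sub_rev]
  exact hn1

end IsTraceVector

end asymptoticNorms

theorem one_add_inv_sq_pow_le (n : ℕ) : (1 + (1 / (n : ℝ)) ^ 2) ^ n ^ 2 ≤ 4 := by
  have h1 : 1 + (1 / (n : ℝ)) ^ 2 ≤ Real.exp ((1 / (n : ℝ)) ^ 2) := by
    rw [add_comm]
    exact Real.add_one_le_exp _
  refine (pow_le_pow_left₀ (by positivity) h1 _).trans ?_
  rw [← Real.exp_nat_mul]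
  have h2 : ((n ^ 2 : ℕ) : ℝ) * (1 / (n : ℝ)) ^ 2 ≤ 1 := by
    rw [Nat.cast_pow, ← mul_pow, mul_one_div]
    exact pow_le_one₀ (by positivity) (div_self_le_one _)
  exact (Real.exp_le_exp.2 h2).trans (by linarith [Real.exp_one_lt_d9])

/-- (Main theorem) There are `K > 0`, `C₀ > 0` such that for every natural `M`
and every irrational `θ ∈ [0,1]` there exist `N ≤ C₀ e^{M²}`, a sequence `(m_j)` of positive
integers with `m_j/m_{j+1} ≤ 3^{−2N}`, a complex Hilbert space `H`, unitaries `U, V` on `H` with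
`U V = e^{2πiθ} V U`, and a unit trace vector `e₀`, such that the modified Riesz product `W_N`
satisfies `max{τ(|δ₁²W_N|), τ(|δ₂²W_N|)} ≤ K` and `τ(|δ₁δ₂W_N|) ≥ M`. -/
theorem stmt_14 :
    ∃ K > (0 : ℝ), ∃ C₀ > (0 : ℝ), ∀ M : ℕ, ∀ θ : ℝ, θ ∈ Set.Icc (0 : ℝ) 1 → Irrational θ →
      ∃ N : ℕ, (N : ℝ) ≤ C₀ * Real.exp ((M : ℝ) ^ 2) ∧
      ∃ m : ℕ → ℕ, (∀ j, 1 ≤ m j) ∧ (∀ j, 3 ^ (2 * N) * m j ≤ m (j + 1)) ∧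
      ∃ S : HilbertSetup, ∃ U V : unitary (S.H →L[ℂ] S.H),
        ((U : S.H →L[ℂ] S.H) * (V : S.H →L[ℂ] S.H)
          = Complex.exp (2 * (Real.pi : ℂ) * Complex.I * (θ : ℂ)) •
              ((V : S.H →L[ℂ] S.H) * (U : S.H →L[ℂ] S.H))) ∧
        ∃ e₀ : S.H, ‖e₀‖ = 1 ∧
          (∀ k : ℤ × ℤ, k ≠ 0 → vecState e₀ (qMono U V k) = 0) ∧
          max (l1Norm e₀ (derivW e₀ U V m N 1 1)) (l1Norm e₀ (derivW e₀ U V m N 2 2)) ≤ K ∧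
          (M : ℝ) ≤ l1Norm e₀ (derivW e₀ U V m N 1 2) := by
  refine ⟨4, by norm_num, 32, by norm_num, fun M θ _ _ => ?_⟩
  set ω : ℂ := Complex.exp (2 * (Real.pi : ℂ) * Complex.I * (θ : ℂ)) with hω
  have hω1 : ‖ω‖ = 1 := by
    rw [hω, show 2 * (Real.pi : ℂ) * Complex.I * (θ : ℂ) = ((2 * π * θ : ℝ) : ℂ) * Complex.I by
      push_cast; ring]
    exact Complex.norm_exp_ofReal_mul_I _
  obtain ⟨S, U, V, e, h⟩ := exists_isTraceVector ω hω1
  set n : ℕ := 4 * (M + 1) with hn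
  set N : ℕ := n ^ 2 with hN
  set ε : ℕ → ℝ := fun i => 1 / ((i : ℝ) + 1) with hε
  have hε0 : ∀ i, 0 < ε i := fun i => by positivity
  set L : ℕ → ℕ := fun i => 3 ^ (2 * N) + (i + 9) with hL
  have hL9 : ∀ i, 9 ≤ L i := fun i => (Nat.le_add_left 9 i).trans (Nat.le_add_left _ _)
  choose m hm hmL hmε using fun i => exists_lacunary_almost_period hω1 (hε0 i)
    (le_trans (by norm_num) (hL9 i))
  have hLtop : Filter.Tendsto L Filter.atTop Filter.atTop :=
    Filter.tendsto_atTop_mono (fun i => (Nat.le_add_right i 9).trans (Nat.le_add_left _ _))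
      Filter.tendsto_id
  have hεt : Filter.Tendsto ε Filter.atTop (nhds 0) := tendsto_one_div_add_atTop_nhds_zero_nat
  have hε0' : ∀ i, 0 ≤ ε i := fun i => (hε0 i).le
  obtain ⟨i, h1, h2, h3⟩ :=
    ((h.eventually_l1Norm_le hL9 hLtop hmL hm hεt hε0' hmε N (Or.inl rfl)).and
      ((h.eventually_l1Norm_le hL9 hLtop hmL hm hεt hε0' hmε N (Or.inr rfl)).and
        (h.eventually_le_l1Norm hL9 hLtop hmL hm hεt hε0' hmε N (a := 1 / (n : ℝ)) (by positivity)
          (one_add_inv_sq_pow_le n)))).exists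
  refine ⟨N, ?_, m i, hm i, fun j => ?_, S, U, V, h.comm, e, h.norm_vec, h.vecState_qMono,
    max_le h1 h2, ?_⟩
  · have h4 := Real.add_one_le_exp ((M : ℝ) ^ 2)
    rw [hN, hn]
    push_cast
    nlinarith [sq_nonneg ((M : ℝ) - 1)]
  · exact (Nat.mul_le_mul_right _ (Nat.le_add_right _ _)).trans (hmL i j)
  · have h4 : 1 / (n : ℝ) / 2 * (N : ℝ) = 2 * (M + 1) := by
      rw [hN, hn]
      push_cast
      field_simp
      ring
    rw [h4] at h3
    linarith
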